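/- arXiv:1009.3545 — 8 statements merged into one kernel-verified Lean document; each statement's English description precedes it below -/
import Mathlib

section
/- Let E be a real separable Banach space and let N and G be σ-finite Borel measures on E with N({0}) = G({0}) = 0 such that for every c > 0: N({x : ‖x‖ > c}) < ∞, G({x : ‖x‖ > c}) < ∞, ∫_{‖x‖>c} log(1+‖x‖) N(dx) < ∞ and ∫_{‖x‖>c} log(1+‖x‖) G(dx) < ∞. Then ∫₀^∞ N(e^s A) ds + N(A) = ∫₀^∞ G(e^s A) ds holds for every Borel set A ⊆ E \ {0} if and only if N(A) = ∫₀¹ G(t⁻¹ A) dt holds for every Borel set A ⊆ E \ {0}. -/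
open MeasureTheory Set Pointwise

theorem lintegral_exp_neg_Ioo {v : ℝ} (hv : 0 < v) :
    ENNReal.ofReal (Real.exp (-v)) + ∫⁻ r in Ioo 0 v, ENNReal.ofReal (Real.exp (-r)) = 1 := by
  have hint : IntegrableOn (fun r : ℝ => Real.exp (-r)) (Ioc 0 v) :=
    (by fun_prop : Continuous fun r : ℝ => Real.exp (-r)).integrableOn_Ioc
  have hval : ∫ r in Ioc 0 v, Real.exp (-r) = 1 - Real.exp (-v) := by
    rw [← intervalIntegral.integral_of_le hv.le,
      intervalIntegral.integral_comp_neg (fun r => Real.exp r), integral_exp]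
    simp
  rw [setLIntegral_congr Ioo_ae_eq_Ioc, ← ofReal_integral_eq_lintegral_ofReal hint
    (ae_of_all _ fun r => (Real.exp_pos _).le), hval,
    ← ENNReal.ofReal_add (Real.exp_pos _).le (by simp [hv.le])]
  simp

theorem setLIntegral_Ioi_comp_add_right (f : ℝ → ENNReal) (r : ℝ) :
    ∫⁻ s in Ioi 0, f (s + r) = ∫⁻ v in Ioi r, f v := by
  have h := (measurePreserving_add_right volume r).setLIntegral_comp_emb
    (measurableEmbedding_addRight r) f (Ioi 0)
  rw [h]
  simp

/-- The resolvent identity between the kernels `1` and `exp (-r)` on the half-line. -/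
theorem lintegral_exp_neg_mul_add_lintegral_exp_neg_mul_lintegral
    {f : ℝ → ENNReal} (hf : Measurable f) :
    (∫⁻ r in Ioi (0 : ℝ), ENNReal.ofReal (Real.exp (-r)) * f r) +
      (∫⁻ r in Ioi (0 : ℝ), ENNReal.ofReal (Real.exp (-r)) * ∫⁻ s in Ioi (0 : ℝ), f (s + r))
      = ∫⁻ s in Ioi (0 : ℝ), f s := by
  have key : (∫⁻ r in Ioi (0 : ℝ), ENNReal.ofReal (Real.exp (-r)) *
        ∫⁻ s in Ioi (0 : ℝ), f (s + r))
      = ∫⁻ v in Ioi (0 : ℝ), (∫⁻ r in Ioo 0 v, ENNReal.ofReal (Real.exp (-r))) * f v := by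
    calc (∫⁻ r in Ioi (0 : ℝ), ENNReal.ofReal (Real.exp (-r)) *
          ∫⁻ s in Ioi (0 : ℝ), f (s + r))
        = ∫⁻ r in Ioi (0 : ℝ), ∫⁻ v in Ioi (0 : ℝ),
            {p : ℝ × ℝ | p.1 < p.2}.indicator
              (fun p => ENNReal.ofReal (Real.exp (-p.1)) * f p.2) (r, v) := by
          refine setLIntegral_congr_fun measurableSet_Ioi fun r hr => ?_
          have hr : 0 < r := hr
          rw [setLIntegral_Ioi_comp_add_right, ← lintegral_const_mul _ hf,
            ← inter_eq_self_of_subset_left (Ioi_subset_Ioi hr.le),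
            ← setLIntegral_indicator measurableSet_Ioi]
          rfl
      _ = ∫⁻ v in Ioi (0 : ℝ), ∫⁻ r in Ioi (0 : ℝ),
            {p : ℝ × ℝ | p.1 < p.2}.indicator
              (fun p => ENNReal.ofReal (Real.exp (-p.1)) * f p.2) (r, v) := by
          refine lintegral_lintegral_swap (Measurable.aemeasurable ?_)
          exact Measurable.indicator (by fun_prop)
            (measurableSet_lt measurable_fst measurable_snd)
      _ = _ := by
          refine setLIntegral_congr_fun measurableSet_Ioi fun v hv => ?_
          rw [← lintegral_mul_const _ (by fun_prop), ← Iio_inter_Ioi,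
            ← setLIntegral_indicator measurableSet_Iio]
          rfl
  rw [key, ← lintegral_add_left (by fun_prop)]
  refine setLIntegral_congr_fun measurableSet_Ioi fun v hv => ?_
  rw [← add_mul, lintegral_exp_neg_Ioo hv, one_mul]

theorem setLIntegral_Ioo_inv_eq_setLIntegral_exp (F : ℝ → ENNReal) :
    ∫⁻ t in Ioo (0 : ℝ) 1, F t⁻¹ =
      ∫⁻ s in Ioi (0 : ℝ), ENNReal.ofReal (Real.exp (-s)) * F (Real.exp s) := by
  have himg : (fun s : ℝ => Real.exp (-s)) '' Ioi 0 = Ioo 0 1 := by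
    ext t
    constructor
    · rintro ⟨s, hs, rfl⟩
      exact ⟨Real.exp_pos _, by simpa using hs⟩
    · rintro ⟨h0, h1⟩
      exact ⟨-Real.log t, by simpa using Real.log_neg h0 h1, by simp [Real.exp_log h0]⟩
  rw [← himg, lintegral_image_eq_lintegral_abs_deriv_mul measurableSet_Ioi
    (f' := fun s => -Real.exp (-s))]
  · simp [Real.exp_neg]
  · intro s _
    simpa using ((hasDerivAt_id s).neg.exp).hasDerivWithinAt
  · intro a _ b _ h
    simpa using h

section Dilation

variable {E : Type*} [NormedAddCommGroup E] [NormedSpace ℝ E]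

theorem mem_exp_smul_set_iff {A : Set E} {s : ℝ} {x : E} :
    x ∈ Real.exp s • A ↔ Real.exp (-s) • x ∈ A := by
  rw [mem_smul_set_iff_inv_smul_mem₀ (Real.exp_ne_zero s), Real.exp_neg]

theorem exp_smul_subset_compl_zero {A : Set E} (hA : A ⊆ {0}ᶜ) (s : ℝ) :
    Real.exp s • A ⊆ {0}ᶜ := by
  rintro _ ⟨x, hx, rfl⟩
  simpa [Real.exp_ne_zero] using hA hx

variable [MeasurableSpace E] [BorelSpace E]

theorem measurableSet_exp_smul_mem [SecondCountableTopology E] {A : Set E}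
    (hA : MeasurableSet A) : MeasurableSet {p : ℝ × E | p.2 ∈ Real.exp p.1 • A} := by
  simp_rw [mem_exp_smul_set_iff]
  exact (by fun_prop : Measurable fun p : ℝ × E => Real.exp (-p.1) • p.2) hA

theorem measurable_measure_exp_smul [SecondCountableTopology E] (M : Measure E) [SFinite M]
    {A : Set E} (hA : MeasurableSet A) : Measurable fun s : ℝ => M (Real.exp s • A) :=
  measurable_measure_prodMk_left (measurableSet_exp_smul_mem hA)

theorem lintegral_measure_exp_smul_lt_top [SecondCountableTopology E] (M : Measure E) [SFinite M]
    {c : ℝ} (hc : 0 < c) (hfin : M {x : E | c < ‖x‖} < ⊤)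
    (hlog : IntegrableOn (fun x : E => Real.log (1 + ‖x‖)) {x : E | c < ‖x‖} M)
    {A : Set E} (hA : MeasurableSet A) (hAc : A ⊆ {x : E | c < ‖x‖}) :
    ∫⁻ s in Ioi (0 : ℝ), M (Real.exp s • A) < ⊤ := by
  have hS : MeasurableSet {x : E | c < ‖x‖} := measurableSet_lt measurable_const measurable_norm
  have hbound : ∀ x : E, volume.restrict (Ioi (0 : ℝ)) {s : ℝ | x ∈ Real.exp s • A} ≤
      {x : E | c < ‖x‖}.indicator
        (fun x => ENNReal.ofReal (Real.log (1 + ‖x‖) - Real.log c)) x := by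
    intro x
    have hsub : ∀ s : ℝ, 0 < s → x ∈ Real.exp s • A → c < ‖x‖ ∧
        s ≤ Real.log (1 + ‖x‖) - Real.log c := by
      intro s hs hx
      have h1 : c < Real.exp (-s) * ‖x‖ := by
        have := hAc (mem_exp_smul_set_iff.1 hx)
        simpa [norm_smul] using this
      have h2 : c * Real.exp s < ‖x‖ := by
        rw [Real.exp_neg, inv_mul_eq_div, lt_div_iff₀ (Real.exp_pos s)] at h1
        exact h1
      have h3 : c < ‖x‖ := by nlinarith [Real.one_lt_exp_iff.2 hs]
      refine ⟨h3, ?_⟩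
      have h4 := Real.log_le_log (by positivity) (h2.le.trans (by linarith : ‖x‖ ≤ 1 + ‖x‖))
      rw [Real.log_mul hc.ne' (Real.exp_ne_zero s), Real.log_exp] at h4
      linarith
    rw [Measure.restrict_apply' measurableSet_Ioi]
    by_cases hx : c < ‖x‖
    · rw [indicator_of_mem (by exact hx)]
      calc _ ≤ volume (Ioc 0 (Real.log (1 + ‖x‖) - Real.log c)) :=
            measure_mono fun s hs => ⟨hs.2, (hsub s hs.2 hs.1).2⟩
        _ = _ := by simp
    · have : {s : ℝ | x ∈ Real.exp s • A} ∩ Ioi 0 = ∅ := by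
        ext s
        simpa using fun h1 h2 => hx (hsub s h2 h1).1
      simp [this]
  have hswap : ∫⁻ s in Ioi (0 : ℝ), M (Real.exp s • A) =
      ∫⁻ x, volume.restrict (Ioi (0 : ℝ)) {s : ℝ | x ∈ Real.exp s • A} ∂M := by
    have hm := measurableSet_exp_smul_mem hA
    exact (Measure.prod_apply (μ := volume.restrict (Ioi (0 : ℝ))) (ν := M) hm).symm.trans
      (Measure.prod_apply_symm hm)
  have hint : IntegrableOn (fun x : E => Real.log (1 + ‖x‖) - Real.log c) {x : E | c < ‖x‖} M :=
    hlog.sub (integrableOn_const hfin.ne)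
  calc _ ≤ _ := hswap.le.trans (lintegral_mono hbound)
    _ = ∫⁻ x in {x : E | c < ‖x‖}, ENNReal.ofReal (Real.log (1 + ‖x‖) - Real.log c) ∂M :=
      lintegral_indicator hS _
    _ < ⊤ := hint.lintegral_lt_top

theorem lintegral_measure_exp_smul_iUnion [SecondCountableTopology E] (M : Measure E) [SFinite M]
    {A : ℕ → Set E} (hA : ∀ n, MeasurableSet (A n)) (hmono : Monotone A) :
    ∫⁻ s in Ioi (0 : ℝ), ENNReal.ofReal (Real.exp (-s)) * M (Real.exp s • ⋃ n, A n) =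
      ⨆ n, ∫⁻ s in Ioi (0 : ℝ), ENNReal.ofReal (Real.exp (-s)) * M (Real.exp s • A n) := by
  have hsm : ∀ s : ℝ, Monotone fun n => Real.exp s • A n :=
    fun s m n h => smul_set_mono (hmono h)
  rw [← lintegral_iSup]
  · simp_rw [smul_set_iUnion, (hsm _).measure_iUnion, ENNReal.mul_iSup]
  · exact fun n => (by fun_prop : Measurable fun s : ℝ => ENNReal.ofReal (Real.exp (-s))).mul
      (measurable_measure_exp_smul M (hA n))
  · exact fun m n h s => mul_le_mul_right (measure_mono (hsm s h)) _

end Dilation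

/-- Corollary 2: the Lévy-spectral-measure form of the factorization property. -/
theorem stmt_1
    {E : Type*} [NormedAddCommGroup E] [NormedSpace ℝ E] [CompleteSpace E]
    [TopologicalSpace.SeparableSpace E] [MeasurableSpace E] [BorelSpace E]
    (N G : Measure E) [SigmaFinite N] [SigmaFinite G]
    (hN0 : N {0} = 0) (hG0 : G {0} = 0)
    (hNfin : ∀ c : ℝ, 0 < c → N {x : E | c < ‖x‖} < ⊤)
    (hGfin : ∀ c : ℝ, 0 < c → G {x : E | c < ‖x‖} < ⊤)
    (hNlog : ∀ c : ℝ, 0 < c →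
      IntegrableOn (fun x : E => Real.log (1 + ‖x‖)) {x : E | c < ‖x‖} N)
    (hGlog : ∀ c : ℝ, 0 < c →
      IntegrableOn (fun x : E => Real.log (1 + ‖x‖)) {x : E | c < ‖x‖} G) :
    (∀ A : Set E, MeasurableSet A → A ⊆ {0}ᶜ →
        (∫⁻ s in Ioi (0 : ℝ), N (Real.exp s • A)) + N A
          = ∫⁻ s in Ioi (0 : ℝ), G (Real.exp s • A))
      ↔
    (∀ A : Set E, MeasurableSet A → A ⊆ {0}ᶜ →
        N A = ∫⁻ t in Ioo (0 : ℝ) 1, G (t⁻¹ • A)) := by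
  have : SecondCountableTopology E := UniformSpace.secondCountable_of_separable E
  have hexp : Measurable fun s : ℝ => ENNReal.ofReal (Real.exp (-s)) := by fun_prop
  have hsm : ∀ (A : Set E), MeasurableSet A → ∀ u : ℝ, MeasurableSet (Real.exp u • A) :=
    fun A hA u => hA.const_smul₀ _
  have hadd : ∀ (A : Set E) (s u : ℝ), Real.exp s • Real.exp u • A = Real.exp (s + u) • A :=
    fun A s u => by rw [smul_smul, Real.exp_add]
  have hresN := fun {A : Set E} (hA : MeasurableSet A) =>
    lintegral_exp_neg_mul_add_lintegral_exp_neg_mul_lintegral (measurable_measure_exp_smul N hA)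
  have hresG := fun {A : Set E} (hA : MeasurableSet A) =>
    lintegral_exp_neg_mul_add_lintegral_exp_neg_mul_lintegral (measurable_measure_exp_smul G hA)
  simp_rw [fun A : Set E => setLIntegral_Ioo_inv_eq_setLIntegral_exp fun t => G (t • A)]
  constructor
  · intro h
    have hfar : ∀ c : ℝ, 0 < c → ∀ A : Set E, MeasurableSet A → A ⊆ {x : E | c < ‖x‖} →
        N A = ∫⁻ s in Ioi (0 : ℝ), ENNReal.ofReal (Real.exp (-s)) * G (Real.exp s • A) := by
      intro c hc A hA hAc
      have hA0 : A ⊆ {0}ᶜ := by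
        intro x hx hx0
        have hx1 : c < ‖x‖ := hAc hx
        rw [mem_singleton_iff.1 hx0, norm_zero] at hx1
        exact hx1.not_gt hc
      have hK : ∫⁻ s in Ioi (0 : ℝ), N (Real.exp s • A) =
          ∫⁻ u in Ioi (0 : ℝ), ENNReal.ofReal (Real.exp (-u)) *
            ∫⁻ s in Ioi (0 : ℝ), G (Real.exp (s + u) • A) := by
        have hm : Measurable fun s : ℝ => ENNReal.ofReal (Real.exp (-s)) * N (Real.exp s • A) :=
          hexp.mul (measurable_measure_exp_smul N hA)
        rw [← hresN hA, ← lintegral_add_left hm]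
        refine lintegral_congr fun u => ?_
        have hu := h _ (hsm A hA u) (exp_smul_subset_compl_zero hA0 u)
        simp only [hadd] at hu
        rw [← hu, mul_add, add_comm]
      have h0 := h A hA hA0
      rw [← hresG hA, ← hK, add_comm] at h0
      exact (ENNReal.add_left_inj (lintegral_measure_exp_smul_lt_top N hc (hNfin c hc)
        (hNlog c hc) hA hAc).ne).1 h0
    intro A hA hA0
    let B : ℕ → Set E := fun n => A ∩ {x | 1 / ((n : ℝ) + 1) < ‖x‖}
    have hB : ∀ n, MeasurableSet (B n) := fun n =>
      hA.inter (measurableSet_lt measurable_const measurable_norm)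
    have hBmono : Monotone B := fun m n hmn x hx =>
      ⟨hx.1, lt_of_le_of_lt (Nat.one_div_le_one_div hmn) (show _ < ‖x‖ from hx.2)⟩
    have hBA : A = ⋃ n, B n := by
      refine Subset.antisymm (fun x hx => ?_) (iUnion_subset fun n => inter_subset_left)
      obtain ⟨n, hn⟩ := exists_nat_one_div_lt (norm_pos_iff.2 (hA0 hx))
      exact mem_iUnion.2 ⟨n, hx, hn⟩
    rw [hBA, hBmono.measure_iUnion, lintegral_measure_exp_smul_iUnion G hB hBmono]
    exact iSup_congr fun n => hfar _ Nat.one_div_pos_of_nat _ (hB n) inter_subset_right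
  · intro h A hA hA0
    have hK : ∫⁻ s in Ioi (0 : ℝ), N (Real.exp s • A) =
        ∫⁻ u in Ioi (0 : ℝ), ENNReal.ofReal (Real.exp (-u)) *
          ∫⁻ s in Ioi (0 : ℝ), G (Real.exp (s + u) • A) := by
      have hG := measurable_measure_exp_smul G hA
      simp_rw [fun s => h _ (hsm A hA s) (exp_smul_subset_compl_zero hA0 s), hadd]
      rw [lintegral_lintegral_swap]
      · refine lintegral_congr fun u => ?_
        simp_rw [add_comm u]
        exact lintegral_const_mul _ (hG.comp (measurable_add_const u))
      · exact ((hexp.comp measurable_snd).mul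
          (hG.comp (measurable_snd.add measurable_fst))).aemeasurable
    rw [hK, h A hA hA0, add_comm]
    exact hresG hA
end

section
/- Let E be a real separable Banach space and let N and N′ be σ-finite Borel measures on E with N({0}) = N′({0}) = 0 such that for every c > 0: N({x : ‖x‖ > c}) < ∞, N′({x : ‖x‖ > c}) < ∞, ∫_{‖x‖>c} log(1+‖x‖) N(dx) < ∞ and ∫_{‖x‖>c} log(1+‖x‖) N′(dx) < ∞. If ∫₀^∞ N(e^s A) ds = ∫₀^∞ N′(e^s A) ds for every Borel set A ⊆ E \ {0}, then N = N′. -/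
open MeasureTheory Set Pointwise
open scoped ENNReal

/-- If `u` and `v` are antitone with equal finite tail integrals and `v` is right-continuous,
then `v ≤ u`. -/
theorem Antitone.le_of_setLIntegral_Ioi_eq {u v : ℝ → ℝ≥0∞} (hu : Antitone u) (hv : Antitone v)
    (hv_right : ∀ a, v a = ⨆ n : ℕ, v (a + 1 / ((n : ℝ) + 1)))
    (hfin : ∀ a, ∫⁻ s in Ioi a, u s ≠ ⊤)
    (heq : ∀ a, ∫⁻ s in Ioi a, u s = ∫⁻ s in Ioi a, v s) (a : ℝ) : v a ≤ u a := by
  by_contra! hlt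
  rw [hv_right, lt_iSup_iff] at hlt
  obtain ⟨n, hn⟩ := hlt
  set δ : ℝ := 1 / ((n : ℝ) + 1)
  have hδ0 : 0 < δ := by positivity
  have split (w : ℝ → ℝ≥0∞) :
      ∫⁻ s in Ioi a, w s = (∫⁻ s in Ioc a (a + δ), w s) + ∫⁻ s in Ioi (a + δ), w s := by
    rw [← Ioc_union_Ioi_eq_Ioi (show a ≤ a + δ by linarith),
      lintegral_union measurableSet_Ioi (Ioc_disjoint_Ioi le_rfl)]
  have hIoc : ∫⁻ s in Ioc a (a + δ), u s = ∫⁻ s in Ioc a (a + δ), v s := by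
    have h := heq a
    rw [split u, split v, ← heq (a + δ)] at h
    exact (ENNReal.add_left_inj (hfin (a + δ))).1 h
  have hle : ∫⁻ s in Ioc a (a + δ), u s ≤ u a * ENNReal.ofReal δ := by
    calc _ ≤ ∫⁻ s in Ioc a (a + δ), u a :=
          setLIntegral_mono measurable_const fun s hs => hu hs.1.le
      _ = _ := by simp
  have hge : v (a + δ) * ENNReal.ofReal δ ≤ ∫⁻ s in Ioc a (a + δ), v s := by
    calc _ = ∫⁻ s in Ioc a (a + δ), v (a + δ) := by simp
      _ ≤ _ := setLIntegral_mono hv.measurable fun s hs => hv hs.2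
  have hmul : u a * ENNReal.ofReal δ < v (a + δ) * ENNReal.ofReal δ :=
    (ENNReal.mul_lt_mul_iff_left (by simpa using hδ0) ENNReal.ofReal_ne_top).2 hn
  exact absurd (hge.trans (hIoc.symm.le.trans hle)) (not_le.2 hmul)

/-- Finite logarithmic moments away from the origin make the integrated tails finite. -/
theorem lintegral_measure_exp_lt_norm_ne_top {E : Type*} [NormedAddCommGroup E]
    [MeasurableSpace E] [BorelSpace E] (N : Measure E)
    (hfin : ∀ c : ℝ, 0 < c → N {x : E | c < ‖x‖} < ⊤)
    (hlog : ∀ c : ℝ, 0 < c →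
      IntegrableOn (fun x : E => Real.log (1 + ‖x‖)) {x : E | c < ‖x‖} N) (a : ℝ) :
    ∫⁻ s in Ioi (0 : ℝ), N {x | Real.exp (s + a) < ‖x‖} ≠ ⊤ := by
  set S : Set E := {x | Real.exp a < ‖x‖}
  have hSm : MeasurableSet S := measurableSet_lt measurable_const measurable_norm
  have hgm : Measurable fun x : E => Real.log ‖x‖ - a := measurable_norm.log.sub_const a
  have hiff {x : E} (hx : x ∈ S) (s : ℝ) : s < Real.log ‖x‖ - a ↔ Real.exp (s + a) < ‖x‖ := by
    rw [lt_sub_iff_add_lt, Real.lt_log_iff_exp_lt ((Real.exp_pos a).trans hx)]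
  have hlayer := lintegral_eq_lintegral_meas_lt (N.restrict S) (f := fun x => Real.log ‖x‖ - a)
    (by
      filter_upwards [ae_restrict_mem hSm] with x hx
      have := (Real.lt_log_iff_exp_lt ((Real.exp_pos a).trans hx)).2 hx
      simpa using this.le) hgm.aemeasurable
  have htail : ∫⁻ s in Ioi (0 : ℝ), N {x | Real.exp (s + a) < ‖x‖}
      = ∫⁻ x in S, ENNReal.ofReal (Real.log ‖x‖ - a) ∂N := by
    rw [hlayer]
    refine setLIntegral_congr_fun measurableSet_Ioi fun s hs => ?_
    rw [Measure.restrict_apply (measurableSet_lt measurable_const hgm)]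
    congr 1
    ext x
    constructor
    · intro hx
      have hxS : x ∈ S := (Real.exp_le_exp.2 (by simpa using hs.le)).trans_lt hx
      exact ⟨(hiff hxS s).2 hx, hxS⟩
    · exact fun hx => (hiff hx.2 s).1 hx.1
  rw [htail]
  have hint : IntegrableOn (fun x : E => Real.log (1 + ‖x‖) + |a|) S N :=
    (hlog _ (Real.exp_pos a)).add (integrableOn_const (hfin _ (Real.exp_pos a)).ne)
  refine ((setLIntegral_mono' hSm fun x hx => ?_).trans_lt hint.lintegral_lt_top).ne
  have hpos : 0 < ‖x‖ := (Real.exp_pos a).trans hx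
  have := Real.log_le_log hpos (show ‖x‖ ≤ 1 + ‖x‖ by linarith)
  exact ENNReal.ofReal_le_ofReal (by linarith [neg_abs_le a])

/-- A measure not charging the origin is determined by its restrictions away from the origin. -/
theorem measure_eq_of_restrict_norm_gt_eq {E : Type*} [NormedAddCommGroup E]
    [MeasurableSpace E] {N N' : Measure E} (hN0 : N {0} = 0) (hN'0 : N' {0} = 0)
    (h : ∀ c : ℝ, 0 < c → N.restrict {x | c < ‖x‖} = N'.restrict {x | c < ‖x‖}) : N = N' := by
  have hcover : ⋃ n : ℕ, {x : E | 1 / ((n : ℝ) + 1) < ‖x‖} = {0}ᶜ := by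
    ext x
    simp only [mem_iUnion, mem_ofPred_eq, mem_compl_iff, mem_singleton_iff]
    constructor
    · rintro ⟨n, hn⟩ rfl
      rw [norm_zero] at hn
      exact absurd hn (not_lt.2 (by positivity))
    · exact fun hx => exists_nat_one_div_lt (norm_pos_iff.2 hx)
  have hres := Measure.restrict_iUnion_congr.2 fun n : ℕ =>
    h (1 / ((n : ℝ) + 1)) (by positivity)
  rw [hcover] at hres
  rwa [Measure.restrict_eq_self_of_ae_mem (s := {0}ᶜ) (compl_mem_ae_iff.2 hN0),
    Measure.restrict_eq_self_of_ae_mem (s := {0}ᶜ) (compl_mem_ae_iff.2 hN'0)] at hres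

section RadialCone

variable {E : Type*} [NormedAddCommGroup E] [NormedSpace ℝ E]

/-- The vectors of norm greater than `r` whose direction lies in `B`. -/
def radialCone (B : Set E) (r : ℝ) : Set E := {x | r < ‖x‖ ∧ ‖x‖⁻¹ • x ∈ B}

theorem smul_radialCone (B : Set E) (r : ℝ) {t : ℝ} (ht : 0 < t) :
    t • radialCone B r = radialCone B (t * r) := by
  ext x
  have hdir : (t⁻¹ * ‖x‖)⁻¹ • t⁻¹ • x = ‖x‖⁻¹ • x := by
    rw [smul_smul]
    congr 1
    field_simp
  rw [mem_smul_set_iff_inv_smul_mem₀ ht.ne']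
  simp only [radialCone, mem_ofPred_eq, norm_smul, norm_inv, Real.norm_eq_abs, abs_of_pos ht, hdir]
  rw [lt_inv_mul_iff₀ ht]

theorem radialCone_antitone (B : Set E) : Antitone (radialCone B) :=
  fun _ _ h _ hx => ⟨h.trans_lt hx.1, hx.2⟩

theorem radialCone_subset (B : Set E) (r : ℝ) : radialCone B r ⊆ {x | r < ‖x‖} :=
  fun _ hx => hx.1

theorem iUnion_radialCone_exp (B : Set E) (a : ℝ) :
    ⋃ n : ℕ, radialCone B (Real.exp (a + 1 / ((n : ℝ) + 1))) = radialCone B (Real.exp a) := by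
  refine Subset.antisymm (iUnion_subset fun n => radialCone_antitone B ?_) fun x hx => ?_
  · exact Real.exp_le_exp.2 (by linarith [show (0 : ℝ) < 1 / ((n : ℝ) + 1) by positivity])
  · have hpos : 0 < ‖x‖ := (Real.exp_pos a).trans hx.1
    have hlog : a < Real.log ‖x‖ := (Real.lt_log_iff_exp_lt hpos).2 hx.1
    obtain ⟨n, hn⟩ := exists_nat_one_div_lt (sub_pos.2 hlog)
    exact mem_iUnion.2 ⟨n, (Real.lt_log_iff_exp_lt hpos).1 (by linarith), hx.2⟩

variable [MeasurableSpace E]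

theorem measure_radialCone_exp_eq_iSup (N : Measure E) (B : Set E) (a : ℝ) :
    N (radialCone B (Real.exp a))
      = ⨆ n : ℕ, N (radialCone B (Real.exp (a + 1 / ((n : ℝ) + 1)))) := by
  rw [← Monotone.measure_iUnion, iUnion_radialCone_exp]
  intro m n hmn
  refine radialCone_antitone B (Real.exp_le_exp.2 ?_)
  gcongr

/-- The integrated dilates of a radial cone as a tail integral. -/
theorem lintegral_measure_smul_radialCone (N : Measure E) (B : Set E) (a : ℝ) :
    ∫⁻ s in Ioi (0 : ℝ), N (Real.exp s • radialCone B (Real.exp a))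
      = ∫⁻ s in Ioi a, N (radialCone B (Real.exp s)) := by
  have hpre : (fun s : ℝ => s + a) ⁻¹' Ioi a = Ioi 0 := by
    ext s
    simp
  rw [← (measurePreserving_add_right volume a).setLIntegral_comp_preimage_emb
    (measurableEmbedding_addRight a) (fun s => N (radialCone B (Real.exp s))), hpre]
  simp only [smul_radialCone _ _ (Real.exp_pos _), Real.exp_add]

variable [BorelSpace E]

theorem measurable_direction [SecondCountableTopology E] :
    Measurable fun x : E => ‖x‖⁻¹ • x :=
  measurable_norm.inv.smul measurable_id

theorem measurableSet_radialCone [SecondCountableTopology E] {B : Set E} (hB : MeasurableSet B)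
    (r : ℝ) : MeasurableSet (radialCone B r) :=
  (measurableSet_lt measurable_const measurable_norm).inter (measurable_direction hB)

/-- Measures agreeing on all radial cones away from the origin agree away from the origin. -/
theorem restrict_eq_of_radialCone_eq [SecondCountableTopology E] {N N' : Measure E} {c : ℝ}
    (hfin : N {x : E | c < ‖x‖} < ⊤)
    (h : ∀ B : Set E, MeasurableSet B → ∀ r, c ≤ r → N (radialCone B r) = N' (radialCone B r)) :
    N.restrict {x | c < ‖x‖} = N'.restrict {x | c < ‖x‖} := by
  set S : Set E := {x | c < ‖x‖} with hS
  have : IsFiniteMeasure (N.restrict S) := ⟨by simpa using hfin⟩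
  have hpolar : Measurable fun x : E => (‖x‖⁻¹ • x, ‖x‖) :=
    measurable_direction.prodMk measurable_norm
  have hcart : Measurable fun p : E × ℝ => p.2 • p.1 := measurable_snd.smul measurable_fst
  have hinv : (fun p : E × ℝ => p.2 • p.1) ∘ (fun x : E => (‖x‖⁻¹ • x, ‖x‖)) = id := by
    ext x
    rcases eq_or_ne x 0 with rfl | hx
    · simp
    · simp [smul_smul, hx]
  have hmap : (N.restrict S).map (fun x : E => (‖x‖⁻¹ • x, ‖x‖))
      = (N'.restrict S).map (fun x : E => (‖x‖⁻¹ • x, ‖x‖)) := by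
    refine Measure.ext_prod fun {B T} hB hT => ?_
    have hrad (M : Measure E) (T : Set ℝ) (hT : MeasurableSet T) :
        (M.restrict (radialCone B c)).map norm T
          = (M.restrict S).map (fun x : E => (‖x‖⁻¹ • x, ‖x‖)) (B ×ˢ T) := by
      rw [Measure.map_apply measurable_norm hT, Measure.map_apply hpolar (hB.prod hT),
        Measure.restrict_apply (measurable_norm hT),
        Measure.restrict_apply (hpolar (hB.prod hT))]
      congr 1
      ext x
      simp only [radialCone, hS, mem_inter_iff, mem_preimage, mem_ofPred_eq, mem_prod]
      tauto
    have hIoi (M : Measure E) (r : ℝ) : (M.restrict (radialCone B c)).map norm (Ioi r)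
        = M (radialCone B (max r c)) := by
      rw [Measure.map_apply measurable_norm measurableSet_Ioi,
        Measure.restrict_apply (measurable_norm measurableSet_Ioi)]
      congr 1
      ext x
      simp only [radialCone, mem_inter_iff, mem_preimage, mem_Ioi, mem_ofPred_eq, max_lt_iff]
      tauto
    have huniv (M : Measure E) : (M.restrict (radialCone B c)).map norm univ
        = M (radialCone B c) := by
      rw [Measure.map_apply measurable_norm MeasurableSet.univ]
      simp
    have : IsFiniteMeasure (N.restrict (radialCone B c)) :=
      ⟨by simpa using (measure_mono (radialCone_subset B c)).trans_lt hfin⟩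
    rw [← hrad N T hT, ← hrad N' T hT]
    congr 1
    refine ext_of_generate_finite (range Ioi) ?_ isPiSystem_Ioi ?_ ?_
    · rw [← borel_eq_generateFrom_Ioi]
      exact BorelSpace.measurable_eq
    · rintro _ ⟨r, rfl⟩
      rw [hIoi, hIoi, h B hB _ (le_max_right r c)]
    · rw [huniv, huniv, h B hB c le_rfl]
  have := congrArg (Measure.map fun p : E × ℝ => p.2 • p.1) hmap
  rwa [Measure.map_map hcart hpolar, Measure.map_map hcart hpolar, hinv, Measure.map_id,
    Measure.map_id] at this

end RadialCone

/-- Uniqueness of the Lévy measure of the BDLP: the map `N ↦ (A ↦ ∫₀^∞ N(e^s A) ds)`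
is injective on Lévy measures with finite logarithmic moments away from the origin. -/
theorem stmt_2
    {E : Type*} [NormedAddCommGroup E] [NormedSpace ℝ E] [CompleteSpace E]
    [TopologicalSpace.SeparableSpace E] [MeasurableSpace E] [BorelSpace E]
    (N N' : Measure E) [SigmaFinite N] [SigmaFinite N']
    (hN0 : N {0} = 0) (hN'0 : N' {0} = 0)
    (hNfin : ∀ c : ℝ, 0 < c → N {x : E | c < ‖x‖} < ⊤)
    (hN'fin : ∀ c : ℝ, 0 < c → N' {x : E | c < ‖x‖} < ⊤)
    (hNlog : ∀ c : ℝ, 0 < c →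
      IntegrableOn (fun x : E => Real.log (1 + ‖x‖)) {x : E | c < ‖x‖} N)
    (hN'log : ∀ c : ℝ, 0 < c →
      IntegrableOn (fun x : E => Real.log (1 + ‖x‖)) {x : E | c < ‖x‖} N')
    (h : ∀ A : Set E, MeasurableSet A → A ⊆ {0}ᶜ →
        (∫⁻ s in Ioi (0 : ℝ), N (Real.exp s • A))
          = ∫⁻ s in Ioi (0 : ℝ), N' (Real.exp s • A)) :
    N = N' := by
  have : SecondCountableTopology E := UniformSpace.secondCountable_of_separable E
  have hanti (M : Measure E) (B : Set E) : Antitone fun s => M (radialCone B (Real.exp s)) :=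
    fun _ _ hst => measure_mono (radialCone_antitone B (Real.exp_le_exp.2 hst))
  have htail (M : Measure E) (hMfin : ∀ c : ℝ, 0 < c → M {x : E | c < ‖x‖} < ⊤)
      (hMlog : ∀ c : ℝ, 0 < c →
        IntegrableOn (fun x : E => Real.log (1 + ‖x‖)) {x : E | c < ‖x‖} M) (B : Set E) (a : ℝ) :
      ∫⁻ s in Ioi a, M (radialCone B (Real.exp s)) ≠ ⊤ := by
    rw [← lintegral_measure_smul_radialCone]
    refine ne_top_of_le_ne_top (lintegral_measure_exp_lt_norm_ne_top M hMfin hMlog a)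
      (lintegral_mono fun s => ?_)
    rw [smul_radialCone _ _ (Real.exp_pos s), ← Real.exp_add]
    exact measure_mono (radialCone_subset B _)
  have heq (B : Set E) (hB : MeasurableSet B) (a : ℝ) :
      ∫⁻ s in Ioi a, N (radialCone B (Real.exp s))
        = ∫⁻ s in Ioi a, N' (radialCone B (Real.exp s)) := by
    rw [← lintegral_measure_smul_radialCone, ← lintegral_measure_smul_radialCone]
    refine h _ (measurableSet_radialCone hB _) fun x hx hx0 => ?_
    have := hx.1
    rw [mem_singleton_iff.1 hx0, norm_zero] at this
    exact absurd this (Real.exp_pos a).not_gt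
  refine measure_eq_of_restrict_norm_gt_eq hN0 hN'0 fun c hc =>
    restrict_eq_of_radialCone_eq (hNfin c hc) fun B hB r hr => ?_
  rw [← Real.exp_log (hc.trans_le hr)]
  exact le_antisymm
    ((hanti N' B).le_of_setLIntegral_Ioi_eq (hanti N B) (measure_radialCone_exp_eq_iSup N B)
      (htail N' hN'fin hN'log B) (fun a => (heq B hB a).symm) _)
    ((hanti N B).le_of_setLIntegral_Ioi_eq (hanti N' B) (measure_radialCone_exp_eq_iSup N' B)
      (htail N hNfin hNlog B) (heq B hB) _)
end

section
/- Let E be a real separable Banach space and let G be a σ-finite Borel measure on E with G({0}) = 0, G({x : ‖x‖ > c}) < ∞ and ∫_{‖x‖>c} log(1+‖x‖) G(dx) < ∞ for every c > 0. Define the measure M by M(A) = ∫₀^∞ ∫₀¹ G(e^t s⁻¹ A) ds dt for Borel A ⊆ E \ {0}. Then for every Borel subset D of the unit sphere S = {x ∈ E : ‖x‖ = 1} and every r > 0, M({x : ‖x‖ > r and x/‖x‖ ∈ D}) = ∫_r^∞ (w − r) w⁻² G({x : ‖x‖ > w and x/‖x‖ ∈ D}) dw. -/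
open MeasureTheory Set Pointwise

/-- Tonelli's theorem on the region `r < u < w`. -/
theorem lintegral_Ioi_lintegral_Ioi {h : ℝ → ENNReal} (hh : Measurable h) (r : ℝ) :
    ∫⁻ u in Ioi r, ∫⁻ w in Ioi u, h w = ∫⁻ w in Ioi r, ENNReal.ofReal (w - r) * h w := by
  have hmeas : Measurable fun p : ℝ × ℝ => {q : ℝ × ℝ | q.1 < q.2}.indicator (fun q => h q.2) p :=
    (hh.comp measurable_snd).indicator (measurableSet_lt measurable_fst measurable_snd)
  calc ∫⁻ u in Ioi r, ∫⁻ w in Ioi u, h w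
      = ∫⁻ u in Ioi r, ∫⁻ w in Ioi r, {q : ℝ × ℝ | q.1 < q.2}.indicator (fun q => h q.2) (u, w) := by
        refine setLIntegral_congr_fun measurableSet_Ioi fun u hu => ?_
        have hsub : Ioi u ⊆ Ioi r := Ioi_subset_Ioi (le_of_lt hu)
        have heq : (fun w => {q : ℝ × ℝ | q.1 < q.2}.indicator (fun q => h q.2) (u, w))
            = (Ioi u).indicator h := by
          ext w; simp [indicator]
        simp only [heq]
        rw [setLIntegral_indicator measurableSet_Ioi, inter_eq_left.2 hsub]
    _ = ∫⁻ w in Ioi r, ∫⁻ u in Ioi r, {q : ℝ × ℝ | q.1 < q.2}.indicator (fun q => h q.2) (u, w) :=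
        lintegral_lintegral_swap hmeas.aemeasurable
    _ = ∫⁻ w in Ioi r, ENNReal.ofReal (w - r) * h w := by
        refine setLIntegral_congr_fun measurableSet_Ioi fun w _ => ?_
        have heq : (fun u => {q : ℝ × ℝ | q.1 < q.2}.indicator (fun q => h q.2) (u, w))
            = (Iio w).indicator fun _ => h w := by
          ext u; simp [indicator]
        simp only [heq]
        rw [setLIntegral_indicator measurableSet_Iio, setLIntegral_const, Iio_inter_Ioi,
          Real.volume_Ioo, mul_comm]

theorem lintegral_Ioo_zero_one_comp_mul_inv (g : ℝ → ENNReal) {a : ℝ} (ha : 0 < a) :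
    ∫⁻ s in Ioo (0 : ℝ) 1, g (a * s⁻¹)
      = ∫⁻ w in Ioi a, ENNReal.ofReal (a / w ^ 2) * g w := by
  have himage : (fun w => a * w⁻¹) '' Ioi a = Ioo (0 : ℝ) 1 := by
    ext s
    constructor
    · rintro ⟨w, hw, rfl⟩
      have hw0 : 0 < w := ha.trans hw
      exact ⟨by positivity, by simpa only [div_eq_mul_inv] using (div_lt_one hw0).2 hw⟩
    · rintro ⟨hs0, hs1⟩
      refine ⟨a * s⁻¹, ?_, by field_simp⟩
      rw [mem_Ioi, ← div_eq_mul_inv, lt_div_iff₀ hs0]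
      exact mul_lt_of_lt_one_right ha hs1
  have hderiv : ∀ w ∈ Ioi a,
      HasDerivWithinAt (fun w => a * w⁻¹) (a * -(w ^ 2)⁻¹) (Ioi a) w := fun w hw =>
    ((hasDerivAt_inv (ha.trans hw).ne').const_mul a).hasDerivWithinAt
  have hinj : InjOn (fun w => a * w⁻¹) (Ioi a) := fun x _ y _ hxy =>
    inv_injective (mul_left_cancel₀ ha.ne' hxy)
  rw [← himage, lintegral_image_eq_lintegral_abs_deriv_mul measurableSet_Ioi hderiv hinj]
  refine setLIntegral_congr_fun measurableSet_Ioi fun w hw => ?_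
  have hw0 : 0 < w := ha.trans hw
  have habs : |a * -(w ^ 2)⁻¹| = a / w ^ 2 := by
    rw [mul_neg, abs_neg, abs_of_pos (by positivity), div_eq_mul_inv]
  have hinv : a * (a * w⁻¹)⁻¹ = w := by field_simp
  simp only [habs, hinv]

theorem lintegral_Ioi_zero_comp_mul_exp (g : ℝ → ENNReal) {r : ℝ} (hr : 0 < r) :
    ∫⁻ t in Ioi (0 : ℝ), ENNReal.ofReal (r * Real.exp t) * g (r * Real.exp t)
      = ∫⁻ u in Ioi r, g u := by
  have himage : (fun t => r * Real.exp t) '' Ioi 0 = Ioi r := by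
    ext u
    constructor
    · rintro ⟨t, ht, rfl⟩
      exact lt_mul_of_one_lt_right hr (Real.one_lt_exp_iff.2 ht)
    · intro hu
      have hu0 : 0 < u := hr.trans hu
      refine ⟨Real.log (u / r), Real.log_pos ((one_lt_div hr).2 hu), ?_⟩
      simp only [Real.exp_log (div_pos hu0 hr)]
      field_simp
  have hderiv : ∀ t ∈ Ioi (0 : ℝ),
      HasDerivWithinAt (fun t => r * Real.exp t) (r * Real.exp t) (Ioi 0) t := fun t _ =>
    ((Real.hasDerivAt_exp t).const_mul r).hasDerivWithinAt
  have hinj : InjOn (fun t => r * Real.exp t) (Ioi 0) := fun x _ y _ hxy =>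
    Real.exp_injective (mul_left_cancel₀ hr.ne' hxy)
  rw [← himage, lintegral_image_eq_lintegral_abs_deriv_mul measurableSet_Ioi hderiv hinj]
  refine setLIntegral_congr_fun measurableSet_Ioi fun t _ => ?_
  simp only [abs_of_pos (mul_pos hr (Real.exp_pos t))]

/-- The double integral of `g (r eᵗ / s)` over `t > 0` and `0 < s < 1`. -/
theorem lintegral_lintegral_comp_mul_exp_mul_inv {g : ℝ → ENNReal} (hg : Measurable g)
    {r : ℝ} (hr : 0 < r) :
    ∫⁻ t in Ioi (0 : ℝ), ∫⁻ s in Ioo (0 : ℝ) 1, g (r * Real.exp t * s⁻¹)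
      = ∫⁻ w in Ioi r, ENNReal.ofReal ((w - r) / w ^ 2) * g w := by
  have hmeas : Measurable fun w : ℝ => ENNReal.ofReal (w ^ 2)⁻¹ * g w := by fun_prop
  calc ∫⁻ t in Ioi (0 : ℝ), ∫⁻ s in Ioo (0 : ℝ) 1, g (r * Real.exp t * s⁻¹)
      = ∫⁻ t in Ioi (0 : ℝ), ENNReal.ofReal (r * Real.exp t) *
          ∫⁻ w in Ioi (r * Real.exp t), ENNReal.ofReal (w ^ 2)⁻¹ * g w := by
        refine lintegral_congr fun t => ?_
        have ha : 0 < r * Real.exp t := by positivity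
        rw [lintegral_Ioo_zero_one_comp_mul_inv g ha, ← lintegral_const_mul _ hmeas]
        refine lintegral_congr fun w => ?_
        rw [div_eq_mul_inv, ENNReal.ofReal_mul ha.le, mul_assoc]
    _ = ∫⁻ u in Ioi r, ∫⁻ w in Ioi u, ENNReal.ofReal (w ^ 2)⁻¹ * g w :=
        lintegral_Ioi_zero_comp_mul_exp
          (fun u => ∫⁻ w in Ioi u, ENNReal.ofReal (w ^ 2)⁻¹ * g w) hr
    _ = ∫⁻ w in Ioi r, ENNReal.ofReal (w - r) * (ENNReal.ofReal (w ^ 2)⁻¹ * g w) :=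
        lintegral_Ioi_lintegral_Ioi hmeas r
    _ = ∫⁻ w in Ioi r, ENNReal.ofReal ((w - r) / w ^ 2) * g w := by
        refine setLIntegral_congr_fun measurableSet_Ioi fun w hw => ?_
        simp only [div_eq_mul_inv, ENNReal.ofReal_mul (sub_nonneg.2 (le_of_lt hw)), mul_assoc]

theorem smul_setOf_lt_norm_and_mem {E : Type*} [NormedAddCommGroup E] [NormedSpace ℝ E]
    (D : Set E) (r : ℝ) {k : ℝ} (hk : 0 < k) :
    k • {x : E | r < ‖x‖ ∧ ‖x‖⁻¹ • x ∈ D} = {x : E | r * k < ‖x‖ ∧ ‖x‖⁻¹ • x ∈ D} := by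
  ext x
  rw [mem_smul_set_iff_inv_smul_mem₀ hk.ne']
  have hnorm : ‖k⁻¹ • x‖ = ‖x‖ / k := by
    rw [norm_smul, norm_inv, Real.norm_of_nonneg hk.le, div_eq_inv_mul]
  have hdir : (‖x‖ / k)⁻¹ • k⁻¹ • x = ‖x‖⁻¹ • x := by
    rw [smul_smul]
    congr 1
    field_simp
  simp only [mem_ofPred_eq, hnorm, hdir, lt_div_iff₀ hk]

/-- Formula (15) of the paper: the Lévy spectral function of
`M(A) = ∫₀^∞ ∫₀¹ G(e^t s⁻¹ A) ds dt` equals `∫_r^∞ (w-r) w⁻² G_D(w) dw`. -/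
theorem stmt_3
    {E : Type*} [NormedAddCommGroup E] [NormedSpace ℝ E] [CompleteSpace E]
    [TopologicalSpace.SeparableSpace E] [MeasurableSpace E] [BorelSpace E]
    (G : Measure E) [SigmaFinite G]
    (hG0 : G {0} = 0)
    (hGfin : ∀ c : ℝ, 0 < c → G {x : E | c < ‖x‖} < ⊤)
    (hGlog : ∀ c : ℝ, 0 < c →
      IntegrableOn (fun x : E => Real.log (1 + ‖x‖)) {x : E | c < ‖x‖} G)
    (D : Set E) (hD : MeasurableSet D) (hDS : D ⊆ {x : E | ‖x‖ = 1})
    (r : ℝ) (hr : 0 < r) :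
    (∫⁻ t in Ioi (0 : ℝ), ∫⁻ s in Ioo (0 : ℝ) 1,
        G ((Real.exp t * s⁻¹) • {x : E | r < ‖x‖ ∧ ‖x‖⁻¹ • x ∈ D}))
      = ∫⁻ w in Ioi r,
          ENNReal.ofReal ((w - r) / w ^ 2) * G {x : E | w < ‖x‖ ∧ ‖x‖⁻¹ • x ∈ D} := by
  have hanti : Antitone fun w : ℝ => G {x : E | w < ‖x‖ ∧ ‖x‖⁻¹ • x ∈ D} :=
    fun v w hvw => measure_mono fun x hx => ⟨hvw.trans_lt hx.1, hx.2⟩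
  rw [← lintegral_lintegral_comp_mul_exp_mul_inv hanti.measurable hr]
  refine lintegral_congr fun t => setLIntegral_congr_fun measurableSet_Ioo fun s hs => ?_
  have hk : 0 < Real.exp t * s⁻¹ := mul_pos (Real.exp_pos t) (inv_pos.2 hs.1)
  simp only [smul_setOf_lt_norm_and_mem D r hk, mul_assoc]
end

section
/- Let g : (0,∞) → [0,∞) be a nonincreasing function with ∫₁^∞ g(w) w⁻² dw < ∞. Then the function h(r) = r ∫_r^∞ g(w) w⁻² dw is finite, nonincreasing and convex on (0,∞). -/
open MeasureTheory Set

lemma integrableOn_Ioi_one_div_sq {r : ℝ} (hr : 0 < r) :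
    IntegrableOn (fun w : ℝ => 1 / w ^ 2) (Ioi r) := by
  refine (integrableOn_Ioi_rpow_of_lt (a := -2) (by norm_num) hr).congr_fun ?_ measurableSet_Ioi
  intro w hw
  have hw0 : 0 < w := hr.trans hw
  simp [Real.rpow_neg hw0.le]

lemma integral_Ioi_one_div_sq {r : ℝ} (hr : 0 < r) :
    ∫ w in Ioi r, (1 : ℝ) / w ^ 2 = 1 / r := by
  have h := integral_Ioi_rpow_of_lt (a := -2) (by norm_num) hr
  have hcongr : ∫ w in Ioi r, (1 : ℝ) / w ^ 2 = ∫ w in Ioi r, w ^ (-2 : ℝ) := by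
    refine setIntegral_congr_fun measurableSet_Ioi fun w hw => ?_
    have hw0 : 0 < w := hr.trans hw
    simp [Real.rpow_neg hw0.le]
  rw [hcongr, h]
  norm_num [Real.rpow_neg_one]

lemma convexOn_of_exists_support_line {s : Set ℝ} (hs : Convex ℝ s) {f : ℝ → ℝ}
    (h : ∀ b ∈ s, ∃ m, ∀ r ∈ s, f b + m * (r - b) ≤ f r) : ConvexOn ℝ s f := by
  refine ⟨hs, fun x hx y hy a b ha hb hab => ?_⟩
  obtain ⟨m, hm⟩ := h _ (hs hx hy ha hb hab)
  have h1 := mul_le_mul_of_nonneg_left (hm x hx) ha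
  have h2 := mul_le_mul_of_nonneg_left (hm y hy) hb
  obtain rfl : b = 1 - a := by linarith
  simp only [smul_eq_mul] at *
  linarith

section

variable {g : ℝ → ℝ}

lemma AntitoneOn.integrableOn_Ioi_div_sq (hg_nonneg : ∀ x ∈ Ioi (0 : ℝ), 0 ≤ g x)
    (hg_anti : AntitoneOn g (Ioi (0 : ℝ)))
    (hg_int : IntegrableOn (fun w => g w / w ^ 2) (Ioi (1 : ℝ))) {r : ℝ} (hr : 0 < r) :
    IntegrableOn (fun w => g w / w ^ 2) (Ioi r) := by
  have hanti : AntitoneOn (fun w => g w / w ^ 2) (Icc r 1) := by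
    intro x hx y hy hxy
    have hx0 : 0 < x := hr.trans_le hx.1
    have hy0 : 0 < y := hr.trans_le hy.1
    exact div_le_div₀ (hg_nonneg x hx0) (hg_anti hx0 hy0 hxy) (by positivity) (by gcongr)
  refine ((hanti.integrableOn_isCompact isCompact_Icc).union hg_int).mono_set fun w hw => ?_
  rcases le_or_gt w 1 with h | h
  · exact Or.inl ⟨le_of_lt hw, h⟩
  · exact Or.inr h

lemma AntitoneOn.mul_le_integral_Ioi_div_sq_sub (hg_anti : AntitoneOn g (Ioi (0 : ℝ)))
    (hgi : ∀ r : ℝ, 0 < r → IntegrableOn (fun w => g w / w ^ 2) (Ioi r))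
    {r b : ℝ} (hr : 0 < r) (hb : 0 < b) :
    g b * (1 / r - 1 / b) ≤ (∫ w in Ioi r, g w / w ^ 2) - ∫ w in Ioi b, g w / w ^ 2 := by
  have hi : ∀ c : ℝ, 0 < c → IntegrableOn (fun w => g w / w ^ 2 - g b * (1 / w ^ 2)) (Ioi c) :=
    fun c hc => (hgi c hc).sub ((integrableOn_Ioi_one_div_sq hc).const_mul _)
  have he : ∀ c : ℝ, 0 < c → ∫ w in Ioi c, (g w / w ^ 2 - g b * (1 / w ^ 2)) =
      (∫ w in Ioi c, g w / w ^ 2) - g b * (1 / c) := fun c hc => by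
    rw [integral_sub (hgi c hc) ((integrableOn_Ioi_one_div_sq hc).const_mul _),
      integral_const_mul, integral_Ioi_one_div_sq hc]
  suffices h : 0 ≤ (∫ w in Ioi r, (g w / w ^ 2 - g b * (1 / w ^ 2))) -
      ∫ w in Ioi b, (g w / w ^ 2 - g b * (1 / w ^ 2)) by
    rw [he r hr, he b hb] at h
    linarith
  have hform : ∀ w : ℝ, g w / w ^ 2 - g b * (1 / w ^ 2) = (g w - g b) / w ^ 2 :=
    fun w => by ring
  rcases le_total r b with h | h
  · rw [intervalIntegral.integral_Ioi_sub_Ioi (hi r hr) h]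
    refine intervalIntegral.integral_nonneg h fun w hw => ?_
    rw [hform]
    exact div_nonneg (sub_nonneg.2 (hg_anti (hr.trans_le hw.1) hb hw.2)) (sq_nonneg w)
  · rw [← neg_sub, intervalIntegral.integral_Ioi_sub_Ioi (hi b hb) h,
      ← intervalIntegral.integral_neg]
    refine intervalIntegral.integral_nonneg h fun w hw => ?_
    rw [hform, neg_nonneg]
    exact div_nonpos_of_nonpos_of_nonneg
      (sub_nonpos.2 (hg_anti hb (hb.trans_le hw.1) hw.1)) (sq_nonneg w)

lemma AntitoneOn.integral_Ioi_div_sq_le (hg_anti : AntitoneOn g (Ioi (0 : ℝ)))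
    (hgi : ∀ r : ℝ, 0 < r → IntegrableOn (fun w => g w / w ^ 2) (Ioi r))
    {b : ℝ} (hb : 0 < b) :
    ∫ w in Ioi b, g w / w ^ 2 ≤ g b / b := by
  calc ∫ w in Ioi b, g w / w ^ 2 ≤ ∫ w in Ioi b, g b * (1 / w ^ 2) := by
        refine setIntegral_mono_on (hgi b hb) ((integrableOn_Ioi_one_div_sq hb).const_mul _)
          measurableSet_Ioi fun w hw => ?_
        rw [mul_one_div]
        exact div_le_div_of_nonneg_right (hg_anti hb (hb.trans hw) (le_of_lt hw)) (sq_nonneg w)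
    _ = g b / b := by rw [integral_const_mul, integral_Ioi_one_div_sq hb, mul_one_div]

lemma AntitoneOn.support_line_mul_integral_Ioi_div_sq (hg_anti : AntitoneOn g (Ioi (0 : ℝ)))
    (hgi : ∀ r : ℝ, 0 < r → IntegrableOn (fun w => g w / w ^ 2) (Ioi r))
    {r b : ℝ} (hr : 0 < r) (hb : 0 < b) :
    (b * ∫ w in Ioi b, g w / w ^ 2) + ((∫ w in Ioi b, g w / w ^ 2) - g b / b) * (r - b) ≤
      r * ∫ w in Ioi r, g w / w ^ 2 := by
  have h := mul_le_mul_of_nonneg_left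
    (hg_anti.mul_le_integral_Ioi_div_sq_sub hgi hr hb) hr.le
  have e : r * (g b * (1 / r - 1 / b)) = -(g b / b) * (r - b) := by
    field_simp
    ring
  rw [e] at h
  linarith

end

/-- Necessity direction of Theorem 2 (analytic content): if `g ≥ 0` is nonincreasing on
`(0,∞)` and `∫₁^∞ g(w)/w² dw < ∞`, then `h(r) = r ∫_r^∞ g(w)/w² dw` is finite,
nonincreasing and convex on `(0,∞)`. -/
theorem stmt_4
    (g : ℝ → ℝ)
    (hg_nonneg : ∀ x ∈ Ioi (0 : ℝ), 0 ≤ g x)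
    (hg_anti : AntitoneOn g (Ioi (0 : ℝ)))
    (hg_int : IntegrableOn (fun w => g w / w ^ 2) (Ioi (1 : ℝ))) :
    (∀ r : ℝ, 0 < r → IntegrableOn (fun w => g w / w ^ 2) (Ioi r)) ∧
    AntitoneOn (fun r => r * ∫ w in Ioi r, g w / w ^ 2) (Ioi (0 : ℝ)) ∧
    ConvexOn ℝ (Ioi (0 : ℝ)) (fun r => r * ∫ w in Ioi r, g w / w ^ 2) := by
  have hgi : ∀ r : ℝ, 0 < r → IntegrableOn (fun w => g w / w ^ 2) (Ioi r) :=
    fun r hr => hg_anti.integrableOn_Ioi_div_sq hg_nonneg hg_int hr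
  refine ⟨hgi, fun a ha b hb hab => ?_, convexOn_of_exists_support_line (convex_Ioi 0)
    fun b hb => ⟨_, fun r hr => hg_anti.support_line_mul_integral_Ioi_div_sq hgi hr hb⟩⟩
  have h1 := hg_anti.support_line_mul_integral_Ioi_div_sq hgi ha hb
  have h2 := mul_nonneg_of_nonpos_of_nonpos
    (sub_nonpos.2 (hg_anti.integral_Ioi_div_sq_le hgi hb)) (sub_nonpos.2 hab)
  simp only
  linarith
end

section
/- Let E be a real separable Banach space and let G be a σ-finite Borel measure on E with G({0}) = 0, G({x : ‖x‖ > c}) < ∞ and ∫_{‖x‖>c} log(1+‖x‖) G(dx) < ∞ for every c > 0. Fix a Borel subset D of the unit sphere and set G_D(w) = G({x : ‖x‖ > w, x/‖x‖ ∈ D}) and L_M(r) = −∫_r^∞ (w − r) w⁻² G_D(w) dw for r > 0. Then L_M is differentiable on (0,∞) with L_M′(r) = ∫_r^∞ G_D(w) w⁻² dw, and at every point r > 0 at which G_D is continuous, L_M is twice differentiable with r² L_M″(r) = −G_D(r); in particular, r ↦ r² L_M″(r) is nondecreasing on the set of continuity points of G_D. -/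
open MeasureTheory Set

/-- Stop-loss transforms are differentiable, with derivative minus the tail integral. -/
lemma hasDerivAt_integral_Ioi_sub_mul {h : ℝ → ℝ} {a r : ℝ} (har : a < r)
    (hh : IntegrableOn h (Ioi a)) (hwh : IntegrableOn (fun w => w * h w) (Ioi a)) :
    HasDerivAt (fun s => ∫ w in Ioi s, (w - s) * h w) (-∫ w in Ioi r, h w) r := by
  have key : HasDerivAt (fun s => ∫ w in Ioi a, max (w - s) 0 * h w)
      (∫ w in Ioi a, (Ioi r).indicator (fun w => -h w) w) r := by
    have hmeas : ∀ s : ℝ, AEStronglyMeasurable (fun w => max (w - s) 0 * h w)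
        (volume.restrict (Ioi a)) := fun s =>
      (by fun_prop : Continuous fun w : ℝ => max (w - s) 0).aestronglyMeasurable.mul
        hh.aestronglyMeasurable
    refine (hasDerivAt_integral_of_dominated_loc_of_lip (bound := fun w => |h w|)
      Filter.univ_mem (Filter.Eventually.of_forall hmeas) ?_ ?_ ?_ hh.abs ?_).2
    · refine Integrable.mono' (hwh.abs.add (hh.abs.const_mul |r|)) (hmeas r) ?_
      filter_upwards with w
      have : |max (w - r) 0| ≤ |w| + |r| :=
        (abs_max_le_max_abs_abs).trans (by
          rw [abs_zero, max_eq_left (abs_nonneg _)]; exact abs_sub w r)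
      simp only [Pi.add_apply, Real.norm_eq_abs, abs_mul]
      nlinarith [abs_nonneg (h w)]
    · exact (hh.aestronglyMeasurable.neg).indicator measurableSet_Ioi
    · filter_upwards with w
      refine LipschitzOnWith.of_dist_le_mul fun x _ y _ => ?_
      rw [Real.dist_eq, Real.dist_eq, ← sub_mul, abs_mul, Real.coe_nnabs, abs_abs, mul_comm]
      refine mul_le_mul_of_nonneg_left ?_ (abs_nonneg _)
      refine (abs_max_sub_max_le_abs (w - x) (w - y) 0).trans_eq ?_
      rw [sub_sub_sub_cancel_left, abs_sub_comm]
    · have hne : ∀ᵐ w ∂(volume.restrict (Ioi a)), w ≠ r :=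
        ae_restrict_of_ae (Measure.ae_ne volume r)
      filter_upwards [hne] with w hw
      rcases lt_or_gt_of_ne hw with hlt | hgt
      · rw [indicator_of_notMem (by simpa using hlt.le)]
        refine (hasDerivAt_const r (0 : ℝ)).congr_of_eventuallyEq ?_
        filter_upwards [lt_mem_nhds hlt] with s hs
        rw [max_eq_right (by linarith), zero_mul]
      · rw [indicator_of_mem (by simpa using hgt)]
        have : HasDerivAt (fun s => (w - s) * h w) (-h w) r := by
          simpa using ((hasDerivAt_id r).const_sub w).mul_const (h w)
        refine this.congr_of_eventuallyEq ?_
        filter_upwards [gt_mem_nhds hgt] with s hs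
        rw [max_eq_left (by linarith)]
  rw [setIntegral_indicator measurableSet_Ioi, Ioi_inter_Ioi, max_eq_right har.le,
    integral_neg] at key
  refine key.congr_of_eventuallyEq ?_
  filter_upwards [lt_mem_nhds har] with s hs
  rw [setIntegral_eq_of_subset_of_forall_sdiff_eq_zero measurableSet_Ioi
    (Ioi_subset_Ioi hs.le) (f := fun w => max (w - s) 0 * h w)]
  · refine setIntegral_congr_fun measurableSet_Ioi fun w hw => ?_
    have : s < w := hw
    simp only [max_eq_left (sub_nonneg.2 this.le)]
  · rintro w ⟨-, hw⟩
    rw [max_eq_right (by simpa using hw), zero_mul]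

lemma hasDerivAt_integral_Ioi {h : ℝ → ℝ} {a r : ℝ} (har : a < r)
    (hh : IntegrableOn h (Ioi a)) (hc : ContinuousAt h r) :
    HasDerivAt (fun s => ∫ w in Ioi s, h w) (-h r) r := by
  have hint : ∀ s, a ≤ s → IntervalIntegrable h volume a s := fun s hs =>
    (intervalIntegrable_iff_integrableOn_Ioc_of_le hs).2 (hh.mono_set Ioc_subset_Ioi_self)
  have hm : StronglyMeasurableAtFilter h (nhds r) :=
    ⟨Ioi a, Ioi_mem_nhds har, hh.aestronglyMeasurable⟩
  refine ((intervalIntegral.integral_hasDerivAt_right (hint r har.le) hm hc).const_sub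
    (∫ w in Ioi a, h w)).congr_of_eventuallyEq ?_
  filter_upwards [lt_mem_nhds har] with s hs
  rw [← intervalIntegral.integral_Ioi_sub_Ioi hh hs.le]
  ring

/-- A logarithmic moment makes the tail function integrable against `dw / (1 + w)`. -/
lemma lintegral_meas_lt_norm_mul_inv_one_add_lt_top {E : Type*} [NormedAddCommGroup E]
    [MeasurableSpace E] [BorelSpace E] {μ : Measure E}
    (hlog : Integrable (fun x : E => Real.log (1 + ‖x‖)) μ) :
    ∫⁻ t in Ioi (0 : ℝ), μ {x | t < ‖x‖} * ENNReal.ofReal ((1 + t)⁻¹) < ⊤ := by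
  have hlin : ∀ t : ℝ, 0 ≤ t → IntervalIntegrable (fun t : ℝ => (1 + t)⁻¹) volume 0 t := by
    intro t ht
    refine ContinuousOn.intervalIntegrable fun x hx => ?_
    rw [uIcc_of_le ht] at hx
    have : 1 + x ≠ 0 := by linarith [hx.1]
    fun_prop (disch := assumption)
  rw [← lintegral_comp_eq_lintegral_meas_lt_mul (g := fun t => (1 + t)⁻¹) μ
    (Filter.Eventually.of_forall fun x => norm_nonneg x) measurable_norm.aemeasurable
    (fun t ht => hlin t ht.le) ?_]
  · refine lt_of_eq_of_lt (lintegral_congr fun x => ?_) hlog.lintegral_lt_top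
    congr 1
    have h0 := norm_nonneg x
    rw [intervalIntegral.integral_comp_add_left (fun t => t⁻¹), add_zero,
      integral_inv_of_pos one_pos (by linarith), div_one]
  · filter_upwards [ae_restrict_mem measurableSet_Ioi] with t ht
    have : (0 : ℝ) < t := ht
    positivity

/-- Corollary 4 of the paper: differentiability of the Lévy spectral function
`L_M(r) = -∫_r^∞ (w-r) w⁻² G_D(w) dw` and the formula `r² L_M''(r) = -G_D(r)`. -/
theorem stmt_5
    {E : Type*} [NormedAddCommGroup E] [NormedSpace ℝ E] [CompleteSpace E]
    [TopologicalSpace.SeparableSpace E] [MeasurableSpace E] [BorelSpace E]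
    (G : Measure E) [SigmaFinite G]
    (hG0 : G {0} = 0)
    (hGfin : ∀ c : ℝ, 0 < c → G {x : E | c < ‖x‖} < ⊤)
    (hGlog : ∀ c : ℝ, 0 < c →
      IntegrableOn (fun x : E => Real.log (1 + ‖x‖)) {x : E | c < ‖x‖} G)
    (D : Set E) (hD : MeasurableSet D) (hDS : D ⊆ {x : E | ‖x‖ = 1})
    (GD LM : ℝ → ℝ)
    (hGD : ∀ w : ℝ, GD w = (G {x : E | w < ‖x‖ ∧ ‖x‖⁻¹ • x ∈ D}).toReal)
    (hLM : ∀ r : ℝ, LM r = -∫ w in Ioi r, (w - r) / w ^ 2 * GD w) :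
    (∀ r : ℝ, 0 < r → HasDerivAt LM (∫ w in Ioi r, GD w / w ^ 2) r) ∧
    (∀ r : ℝ, 0 < r → ContinuousAt GD r →
        HasDerivAt (deriv LM) (-(GD r) / r ^ 2) r) ∧
    MonotoneOn (fun r => r ^ 2 * deriv (deriv LM) r)
      {r : ℝ | 0 < r ∧ ContinuousAt GD r} := by
  have hGw : ∀ w : ℝ, 0 < w → G {x : E | w < ‖x‖ ∧ ‖x‖⁻¹ • x ∈ D} ≠ ⊤ := fun w hw =>
    ((measure_mono fun x hx => hx.1).trans_lt (hGfin w hw)).ne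
  have hnonneg : ∀ w, 0 ≤ GD w := fun w => by rw [hGD]; exact ENNReal.toReal_nonneg
  have hanti : AntitoneOn GD (Ioi 0) := by
    intro u hu v _ huv
    rw [hGD, hGD]
    exact ENNReal.toReal_mono (hGw u hu)
      (measure_mono fun x hx => ⟨huv.trans_lt hx.1, hx.2⟩)
  have hmeas : ∀ a : ℝ, 0 < a → AEStronglyMeasurable GD (volume.restrict (Ioi a)) :=
    fun a ha => (aemeasurable_restrict_of_antitoneOn measurableSet_Ioi
      (hanti.mono (Ioi_subset_Ioi ha.le))).aestronglyMeasurable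
  have hint : ∀ a : ℝ, 0 < a → IntegrableOn (fun w => (1 + w)⁻¹ * GD w) (Ioi a) := by
    intro a ha
    refine ⟨(by fun_prop : Measurable fun w : ℝ => (1 + w)⁻¹).aestronglyMeasurable.mul
      (hmeas a ha), ?_⟩
    refine lt_of_le_of_lt ?_ (lintegral_meas_lt_norm_mul_inv_one_add_lt_top (hGlog a ha))
    refine (setLIntegral_mono' measurableSet_Ioi fun w hw => ?_).trans
      (lintegral_mono_set (Ioi_subset_Ioi ha.le))
    have haw : a < w := hw
    have hw0 : 0 < w := ha.trans haw
    rw [Real.enorm_eq_ofReal (mul_nonneg (by positivity) (hnonneg w)), mul_comm,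
      ENNReal.ofReal_mul (hnonneg w), hGD, ENNReal.ofReal_toReal (hGw w hw0),
      Measure.restrict_apply (measurableSet_lt measurable_const measurable_norm)]
    gcongr
    exact fun x hx => ⟨hx.1, haw.trans hx.1⟩
  have hint1 : ∀ a : ℝ, 0 < a → IntegrableOn (fun w => w * (GD w / w ^ 2)) (Ioi a) := by
    intro a ha
    refine Integrable.mono' ((hint a ha).const_mul (1 + a⁻¹)) ?_ ?_
    · exact (by fun_prop : Measurable fun w : ℝ => w).aestronglyMeasurable.mul
        ((hmeas a ha).div₀ (by fun_prop : Measurable fun w : ℝ => w ^ 2).aestronglyMeasurable)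
    · filter_upwards [ae_restrict_mem measurableSet_Ioi] with w hw
      have haw : a < w := hw
      have hw0 : 0 < w := ha.trans haw
      have hg := hnonneg w
      rw [Real.norm_of_nonneg (by positivity), ← mul_assoc]
      have : w * (GD w / w ^ 2) = w⁻¹ * GD w := by field_simp
      rw [this]
      gcongr
      field_simp
      nlinarith
  have hint2 : ∀ a : ℝ, 0 < a → IntegrableOn (fun w => GD w / w ^ 2) (Ioi a) := by
    intro a ha
    refine Integrable.mono' ((hint1 a ha).const_mul a⁻¹) ((hmeas a ha).div₀
      (by fun_prop : Measurable fun w : ℝ => w ^ 2).aestronglyMeasurable) ?_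
    filter_upwards [ae_restrict_mem measurableSet_Ioi] with w hw
    have haw : a < w := hw
    have hw0 : 0 < w := ha.trans haw
    have hg := hnonneg w
    rw [Real.norm_of_nonneg (by positivity), ← mul_assoc]
    refine le_mul_of_one_le_left (by positivity) ?_
    rw [inv_mul_eq_div]
    exact (one_le_div ha).2 haw.le
  have hLM' : LM = fun r => -∫ w in Ioi r, (w - r) * (GD w / w ^ 2) := by
    funext r
    rw [hLM]
    congr 2
    funext w
    ring
  have hfirst : ∀ r : ℝ, 0 < r → HasDerivAt LM (∫ w in Ioi r, GD w / w ^ 2) r := by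
    intro r hr
    rw [hLM']
    have := (hasDerivAt_integral_Ioi_sub_mul (half_lt_self hr)
      (hint2 _ (half_pos hr)) (hint1 _ (half_pos hr))).fun_neg
    rwa [neg_neg] at this
  have hsecond : ∀ r : ℝ, 0 < r → ContinuousAt GD r →
      HasDerivAt (deriv LM) (-(GD r) / r ^ 2) r := by
    intro r hr hc
    rw [neg_div]
    refine (hasDerivAt_integral_Ioi (half_lt_self hr) (hint2 _ (half_pos hr))
      (hc.div (by fun_prop) (by positivity))).congr_of_eventuallyEq ?_
    filter_upwards [lt_mem_nhds hr] with s hs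
    exact (hfirst s hs).deriv
  refine ⟨hfirst, hsecond, ?_⟩
  rintro u ⟨hu, hcu⟩ v ⟨hv, hcv⟩ huv
  simp only [(hsecond u hu hcu).deriv, (hsecond v hv hcv).deriv]
  rw [mul_div_cancel₀ _ (by positivity), mul_div_cancel₀ _ (by positivity)]
  exact neg_le_neg (hanti hu hv huv)
end

section
/- Let E be a real normed space, let x ∈ E with x ≠ 0, and let c > 0. Then for every Borel set A ⊆ E, ∫₀^∞ ∫₀¹ c·1_A(e^{−t} s x) ds dt = (c/‖x‖) ∫₀^{‖x‖} (‖x‖/v − 1)·1_A(v·x/‖x‖) dv. Equivalently, the measure A ↦ ∫₀^∞∫₀¹ G(e^t s⁻¹ A) ds dt built from G = c·δ_x equals the measure K_{α,β,z}(A) = α ∫₀^β (β/v − 1) δ_{vz}(A) dv with α = c/‖x‖, β = ‖x‖ and z = x/‖x‖. -/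
open MeasureTheory Set
open scoped ENNReal

/-- Scaling an integral over `(0, a)` to the unit interval. -/
theorem lintegral_Ioo_zero_eq_mul_lintegral_unit (f : ℝ → ℝ≥0∞) (hf : Measurable f) {a : ℝ}
    (ha : 0 < a) :
    ∫⁻ u in Ioo (0 : ℝ) a, f u
      = ENNReal.ofReal a * ∫⁻ s in Ioo (0 : ℝ) 1, f (a * s) := by
  have himage : (fun s : ℝ => a * s) '' Ioo 0 1 = Ioo 0 a := by
    rw [image_mul_left_Ioo ha, mul_zero, mul_one]
  rw [← himage, lintegral_image_eq_lintegral_abs_deriv_mul measurableSet_Ioo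
    (f' := fun _ => a) (fun s _ => by simpa using ((hasDerivAt_id s).const_mul a).hasDerivWithinAt)
    (mul_right_injective₀ ha.ne').injOn, abs_of_pos ha,
    lintegral_const_mul _ (by fun_prop)]

theorem image_exp_Ioo (a b : ℝ) : Real.exp '' Ioo a b = Ioo (Real.exp a) (Real.exp b) := by
  ext y
  constructor
  · rintro ⟨t, ⟨h₁, h₂⟩, rfl⟩
    exact ⟨Real.exp_lt_exp.2 h₁, Real.exp_lt_exp.2 h₂⟩
  · rintro ⟨h₁, h₂⟩
    have hy : 0 < y := (Real.exp_pos a).trans h₁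
    exact ⟨Real.log y, ⟨(Real.lt_log_iff_exp_lt hy).2 h₁, (Real.log_lt_iff_lt_exp hy).2 h₂⟩,
      Real.exp_log hy⟩

theorem lintegral_exp_Ioo (a b : ℝ) :
    ∫⁻ t in Ioo a b, ENNReal.ofReal (Real.exp t)
      = ENNReal.ofReal (Real.exp b - Real.exp a) := by
  have h := lintegral_image_eq_lintegral_abs_deriv_mul (s := Ioo a b) measurableSet_Ioo
    (fun t _ => (Real.hasDerivAt_exp t).hasDerivWithinAt) Real.exp_injective.injOn
    (fun _ => 1)
  simpa [image_exp_Ioo] using h.symm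

/-- Averaging `f (e^{-t} s)` over `s ∈ (0, 1)` and `t > 0` weights `f` by `u⁻¹ - 1`. -/
theorem lintegral_lintegral_exp_neg_mul (f : ℝ → ℝ≥0∞) (hf : Measurable f) :
    ∫⁻ t in Ioi (0 : ℝ), ∫⁻ s in Ioo (0 : ℝ) 1, f (Real.exp (-t) * s)
      = ∫⁻ u in Ioo (0 : ℝ) 1, ENNReal.ofReal (u⁻¹ - 1) * f u := by
  have hS : MeasurableSet {p : ℝ × ℝ | 0 < p.1 ∧ 0 < p.2 ∧ p.2 < Real.exp (-p.1)} :=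
    (measurableSet_lt measurable_const measurable_fst).inter
      ((measurableSet_lt measurable_const measurable_snd).inter
        (measurableSet_lt measurable_snd (by fun_prop)))
  set S := {p : ℝ × ℝ | 0 < p.1 ∧ 0 < p.2 ∧ p.2 < Real.exp (-p.1)} with hSdef
  set g : ℝ × ℝ → ℝ≥0∞ := S.indicator fun p => ENNReal.ofReal (Real.exp p.1) * f p.2 with hg
  have hgm : Measurable g := Measurable.indicator (by fun_prop) hS
  have hleft : ∫⁻ t in Ioi (0 : ℝ), ∫⁻ s in Ioo (0 : ℝ) 1, f (Real.exp (-t) * s)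
      = ∫⁻ t, ∫⁻ u, g (t, u) := by
    rw [← lintegral_indicator measurableSet_Ioi]
    refine lintegral_congr fun t => ?_
    by_cases ht : 0 < t
    · have hfun : (fun u => g (t, u))
          = (Ioo 0 (Real.exp (-t))).indicator fun u => ENNReal.ofReal (Real.exp t) * f u := by
        ext u
        simp [hg, hSdef, indicator_apply, ht]
      rw [indicator_of_mem (mem_Ioi.2 ht), hfun, lintegral_indicator measurableSet_Ioo,
        lintegral_const_mul _ hf,
        lintegral_Ioo_zero_eq_mul_lintegral_unit f hf (Real.exp_pos _), ← mul_assoc,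
        ← ENNReal.ofReal_mul (Real.exp_pos _).le, ← Real.exp_add]
      simp
    · simp [hg, hSdef, ht]
  have hright : ∫⁻ u in Ioo (0 : ℝ) 1, ENNReal.ofReal (u⁻¹ - 1) * f u
      = ∫⁻ u, ∫⁻ t, g (t, u) := by
    rw [← lintegral_indicator measurableSet_Ioo]
    refine lintegral_congr fun u => ?_
    by_cases hu : 0 < u
    · have hfun : (fun t => g (t, u))
          = (Ioo 0 (-Real.log u)).indicator fun t => ENNReal.ofReal (Real.exp t) * f u := by
        ext t
        have hiff : u < Real.exp (-t) ↔ t < -Real.log u := by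
          rw [← Real.log_lt_iff_lt_exp hu, lt_neg]
        simp [hg, hSdef, indicator_apply, hu, hiff]
      rw [hfun, lintegral_indicator measurableSet_Ioo, lintegral_mul_const _ (by fun_prop),
        lintegral_exp_Ioo, Real.exp_neg, Real.exp_log hu, Real.exp_zero]
      by_cases hu1 : u < 1
      · rw [indicator_of_mem (mem_Ioo.2 ⟨hu, hu1⟩)]
      · rw [indicator_of_notMem (fun h => hu1 h.2), ENNReal.ofReal_of_nonpos, zero_mul]
        exact sub_nonpos.2 (inv_le_one_of_one_le₀ (not_lt.1 hu1))
    · simp [hg, hSdef, hu]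
  rw [hleft, hright]
  exact lintegral_lintegral_swap hgm.aemeasurable

/-- Example A.2 of the paper: for `G = c·δ_x` the measure
`A ↦ ∫₀^∞ ∫₀¹ G(e^t s⁻¹ A) ds dt` equals `K_{α,β,z}` with `α = c/‖x‖`, `β = ‖x‖`,
`z = x/‖x‖`. -/
theorem stmt_9
    {E : Type*} [NormedAddCommGroup E] [NormedSpace ℝ E]
    [MeasurableSpace E] [BorelSpace E]
    (x : E) (hx : x ≠ 0) (c : ℝ) (hc : 0 < c)
    (A : Set E) (hA : MeasurableSet A) :
    (∫⁻ t in Ioi (0 : ℝ), ∫⁻ s in Ioo (0 : ℝ) 1,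
        ENNReal.ofReal c * A.indicator (fun _ => (1 : ℝ≥0∞)) ((Real.exp (-t) * s) • x))
      = ENNReal.ofReal (c / ‖x‖) *
          ∫⁻ v in Ioo (0 : ℝ) ‖x‖,
            ENNReal.ofReal (‖x‖ / v - 1) *
              A.indicator (fun _ => (1 : ℝ≥0∞)) (v • (‖x‖⁻¹ • x)) := by
  have hnorm : 0 < ‖x‖ := norm_pos_iff.2 hx
  have hind (y : E) : Measurable fun u : ℝ => A.indicator (fun _ => (1 : ℝ≥0∞)) (u • y) :=
    (measurable_const.indicator hA).comp
      (continuous_id.smul continuous_const : Continuous fun u : ℝ => u • y).measurable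
  rw [lintegral_lintegral_exp_neg_mul
      (fun u => ENNReal.ofReal c * A.indicator (fun _ => 1) (u • x)) ((hind x).const_mul _),
    lintegral_Ioo_zero_eq_mul_lintegral_unit
      (fun v => ENNReal.ofReal (‖x‖ / v - 1) * A.indicator (fun _ => 1) (v • (‖x‖⁻¹ • x)))
      (Measurable.mul (by fun_prop) (hind (‖x‖⁻¹ • x))) hnorm,
    ← mul_assoc, ← ENNReal.ofReal_mul (by positivity), div_mul_cancel₀ _ hnorm.ne',
    ← lintegral_const_mul' _ _ ENNReal.ofReal_ne_top]
  refine lintegral_congr fun u => ?_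
  have hdiv : ‖x‖ / (‖x‖ * u) = u⁻¹ := by
    rw [div_mul_eq_div_div, div_self hnorm.ne', one_div]
  have hsmul : (‖x‖ * u) • ‖x‖⁻¹ • x = u • x := by
    rw [smul_smul, mul_comm, inv_mul_cancel_left₀ hnorm.ne']
  rw [hdiv, hsmul, mul_left_comm]
end

section
/- For every α > 0 and λ > 0, the Gamma distribution γ_{α,λ} on ℝ, with density x ↦ (λ^α/Γ(α)) x^{α−1} e^{−λx} on (0,∞), is selfdecomposable: for every c ∈ (0,1) there exists a probability measure μ_c on ℝ such that γ_{α,λ} = (T_c γ_{α,λ}) ∗ μ_c. -/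
open MeasureTheory Set ProbabilityTheory

/-- A Borel probability measure `μ` on `ℝ` is selfdecomposable if for every `c ∈ (0,1)`
there is a probability measure `ν` with `μ = (T_c μ) ∗ ν`. -/
def SelfDecomposable (μ : Measure ℝ) : Prop :=
  ∀ c : ℝ, c ∈ Ioo (0 : ℝ) 1 →
    ∃ ν : Measure ℝ, IsProbabilityMeasure ν ∧
      μ = MeasureTheory.Measure.conv (μ.map (fun x => c * x)) ν

open scoped ENNReal Nat

theorem lintegral_comp_const_mul {a : ℝ} (ha : 0 < a) {f : ℝ → ℝ≥0∞} (hf : Measurable f) :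
    ∫⁻ x, f (a * x) = ENNReal.ofReal a⁻¹ * ∫⁻ x, f x := by
  rw [← lintegral_map hf (measurable_const_mul a), Real.map_volume_mul_left ha.ne',
    lintegral_smul_measure, abs_of_pos (inv_pos.mpr ha), smul_eq_mul]

@[fun_prop]
theorem measurable_gammaPDF (a r : ℝ) : Measurable (gammaPDF a r) :=
  (measurable_gammaPDFReal a r).ennreal_ofReal

/-- Scaling a Gamma law by `c` divides its rate by `c`. -/
theorem map_const_mul_gammaMeasure (a : ℝ) {r c : ℝ} (hr : 0 < r) (hc : 0 < c) :
    (gammaMeasure a r).map (fun x => c * x) = gammaMeasure a (r / c) := by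
  have hpdf (x : ℝ) : gammaPDF a r x = ENNReal.ofReal c * gammaPDF a (r / c) (c * x) := by
    rcases lt_trichotomy x 0 with hx | rfl | hx
    · rw [gammaPDF_of_neg hx, gammaPDF_of_neg (mul_neg_of_pos_of_neg hc hx), mul_zero]
    · rw [mul_zero, gammaPDF_of_nonneg le_rfl, gammaPDF_of_nonneg le_rfl,
        ← ENNReal.ofReal_mul hc.le, Real.div_rpow hr.le hc.le]
      by_cases ha : a = 1
      · subst ha
        simp
        field_simp
      · simp [Real.zero_rpow (sub_ne_zero.mpr ha)]
    · rw [gammaPDF_of_nonneg hx.le, gammaPDF_of_nonneg (mul_pos hc hx).le,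
        ← ENNReal.ofReal_mul hc.le, Real.div_rpow hr.le hc.le, Real.mul_rpow hc.le hx.le,
        Real.rpow_sub_one hc.ne']
      congr 1
      have := (Real.rpow_pos_of_pos hc a).ne'
      have hexp : r / c * (c * x) = r * x := by field_simp
      rw [hexp]
      field_simp
  ext s hs
  have hm : Measurable fun x : ℝ => c * x := measurable_const_mul c
  rw [Measure.map_apply hm hs, gammaMeasure, gammaMeasure, withDensity_apply _ (hm hs),
    withDensity_apply _ hs, ← lintegral_indicator (hm hs), ← lintegral_indicator hs]
  have hind (x : ℝ) : ((fun x => c * x) ⁻¹' s).indicator (gammaPDF a r) x =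
      ENNReal.ofReal c * s.indicator (gammaPDF a (r / c)) (c * x) := by
    by_cases hx : c * x ∈ s
    · rw [indicator_of_mem hx, indicator_of_mem (show x ∈ (fun x => c * x) ⁻¹' s from hx), hpdf]
    · rw [indicator_of_notMem hx,
        indicator_of_notMem (show x ∉ (fun x => c * x) ⁻¹' s from hx), mul_zero]
  have hmeas : Measurable (s.indicator (gammaPDF a (r / c))) :=
    (measurable_gammaPDF a (r / c)).indicator hs
  simp_rw [hind]
  rw [lintegral_const_mul _ (by fun_prop), lintegral_comp_const_mul hc hmeas, ← mul_assoc,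
    ← ENNReal.ofReal_mul hc.le, mul_inv_cancel₀ hc.ne', ENNReal.ofReal_one, one_mul]

/-- Conditionally on a sum of independent Gamma variables being `x`, the first summand divided by
`x` has a Beta density. -/
theorem gammaPDF_mul_gammaPDF {a b r x y : ℝ} (ha : 0 < a) (hb : 0 < b) (hr : 0 < r)
    (hx : 0 < x) (hy : y ≠ 0) (hyx : y ≠ x) :
    gammaPDF a r y * gammaPDF b r (-y + x) =
      gammaPDF (a + b) r x * ENNReal.ofReal x⁻¹ * betaPDF a b (x⁻¹ * y) := by
  rcases lt_or_gt_of_ne hy with hy | hy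
  · rw [gammaPDF_of_neg hy, betaPDF_eq_zero_of_nonpos
      (mul_nonpos_of_nonneg_of_nonpos (inv_pos.mpr hx).le hy.le), zero_mul, mul_zero]
  rcases lt_or_gt_of_ne hyx with hyx | hyx
  · have hz : 0 < x - y := sub_pos.mpr hyx
    have h1 : x⁻¹ * y < 1 := by rw [inv_mul_lt_iff₀ hx]; simpa using hyx
    have h2 : 1 - x⁻¹ * y = x⁻¹ * (x - y) := by field_simp
    have hxi : 0 ≤ x⁻¹ := (inv_pos.mpr hx).le
    rw [neg_add_eq_sub, betaPDF_of_pos_lt_one (mul_pos (inv_pos.mpr hx) hy) h1,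
      gammaPDF_of_nonneg hy.le, gammaPDF_of_nonneg hz.le, gammaPDF_of_nonneg hx.le,
      ← ENNReal.ofReal_mul (by positivity), ← ENNReal.ofReal_mul (by positivity),
      ← ENNReal.ofReal_mul (by positivity), h2, Real.mul_rpow hxi hy.le,
      Real.mul_rpow hxi hz.le, Real.inv_rpow hx.le, Real.inv_rpow hx.le, beta,
      Real.rpow_add hr, show a + b - 1 = (a - 1) + (b - 1) + 1 by ring, Real.rpow_add hx,
      Real.rpow_add hx, Real.rpow_one,
      show -(r * x) = -(r * y) + -(r * (x - y)) by ring, Real.exp_add]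
    congr 1
    have := (Real.rpow_pos_of_pos hx (a - 1)).ne'
    have := (Real.rpow_pos_of_pos hx (b - 1)).ne'
    have := (Real.Gamma_pos_of_pos ha).ne'
    have := (Real.Gamma_pos_of_pos hb).ne'
    have := (Real.Gamma_pos_of_pos (add_pos ha hb)).ne'
    field_simp
  · rw [gammaPDF_of_neg (x := -y + x) (by linarith), betaPDF_eq_zero_of_one_le, mul_zero, mul_zero]
    rw [le_inv_mul_iff₀ hx]
    linarith

/-- Gamma laws with a common rate form a convolution semigroup in the shape parameter. -/
theorem gammaMeasure_conv_gammaMeasure {a b r : ℝ} (ha : 0 < a) (hb : 0 < b) (hr : 0 < r) :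
    (gammaMeasure a r).conv (gammaMeasure b r) = gammaMeasure (a + b) r := by
  rw [gammaMeasure, gammaMeasure, gammaMeasure,
    conv_withDensity_eq_lconvolution (measurable_gammaPDF a r) (measurable_gammaPDF b r)]
  refine withDensity_congr_ae ?_
  filter_upwards [compl_mem_ae_iff.mpr (measure_singleton (0 : ℝ))] with x hx
  rw [lconvolution_def]
  rcases lt_or_gt_of_ne (show x ≠ 0 from hx) with hx | hx
  · rw [gammaPDF_of_neg hx, lintegral_eq_zero_iff (by fun_prop)]
    refine ae_of_all _ fun y => ?_
    rcases lt_or_ge y 0 with hy | hy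
    · simp [gammaPDF_of_neg hy]
    · simp [gammaPDF_of_neg (x := -y + x) (by linarith)]
  · have hbeta : Measurable (betaPDF a b) := (measurable_betaPDFReal a b).ennreal_ofReal
    have hae : (fun y => gammaPDF a r y * gammaPDF b r (-y + x)) =ᵐ[volume]
        fun y => gammaPDF (a + b) r x * ENNReal.ofReal x⁻¹ * betaPDF a b (x⁻¹ * y) := by
      filter_upwards [compl_mem_ae_iff.mpr (measure_singleton (0 : ℝ)),
        compl_mem_ae_iff.mpr (measure_singleton x)] with y hy hyx
      exact gammaPDF_mul_gammaPDF ha hb hr hx hy hyx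
    rw [lintegral_congr_ae hae, lintegral_const_mul _ (by fun_prop),
      lintegral_comp_const_mul (inv_pos.mpr hx) hbeta, lintegral_betaPDF_eq_one ha hb, inv_inv,
      mul_one, mul_assoc, ← ENNReal.ofReal_mul (inv_pos.mpr hx).le, inv_mul_cancel₀ hx.ne',
      ENNReal.ofReal_one, mul_one]

/-- The weights `Γ(a + n) / (Γ(a) n!) * c ^ a * (1 - c) ^ n` of the negative binomial law. -/
noncomputable def negBinomialWeight (a c : ℝ) (n : ℕ) : ℝ :=
  Real.Gamma (a + n) / (Real.Gamma a * n !) * c ^ a * (1 - c) ^ n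

theorem negBinomialWeight_nonneg {a c : ℝ} (ha : 0 < a) (hc : 0 < c) (hc1 : c < 1) (n : ℕ) :
    0 ≤ negBinomialWeight a c n := by
  have : 0 < 1 - c := sub_pos.mpr hc1
  have := Real.Gamma_pos_of_pos ha
  have := Real.Gamma_pos_of_pos (show 0 < a + n by positivity)
  unfold negBinomialWeight
  positivity

theorem hasSum_negBinomialWeight_mul_gammaPDFReal {a r c x : ℝ} (ha : 0 < a) (hr : 0 < r)
    (hc : 0 < c) (hx : 0 < x) :
    HasSum (fun n : ℕ => negBinomialWeight a c n * gammaPDFReal (a + n) (r / c) x)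
      (gammaPDFReal a r x) := by
  have hsum := (NormedSpace.expSeries_div_hasSum_exp ((1 - c) * (r / c) * x)).mul_left
    (r ^ a / Real.Gamma a * x ^ (a - 1) * Real.exp (-(r / c * x)))
  rw [← Real.exp_eq_exp_ℝ] at hsum
  convert! hsum using 1
  · ext n
    have := (Real.Gamma_pos_of_pos ha).ne'
    have := (Real.Gamma_pos_of_pos (show 0 < a + n by positivity)).ne'
    have := (Real.rpow_pos_of_pos hc a).ne'
    rw [negBinomialWeight, gammaPDFReal, if_pos hx.le, Real.rpow_add (div_pos hr hc),
      Real.rpow_natCast, Real.div_rpow hr.le hc.le, show a + n - 1 = a - 1 + n by ring,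
      Real.rpow_add hx, Real.rpow_natCast, mul_pow, mul_pow]
    field_simp
  · rw [gammaPDFReal, if_pos hx.le, mul_assoc _ (Real.exp _), ← Real.exp_add]
    congr 2
    field_simp
    ring

/-- A Gamma law is a negative binomial mixture of Gamma laws with a larger rate. -/
theorem gammaMeasure_eq_sum {a r c : ℝ} (ha : 0 < a) (hr : 0 < r) (hc : 0 < c) (hc1 : c < 1) :
    gammaMeasure a r = Measure.sum fun n : ℕ =>
      ENNReal.ofReal (negBinomialWeight a c n) • gammaMeasure (a + n) (r / c) := by
  simp_rw [gammaMeasure, ← withDensity_smul _ (measurable_gammaPDF _ _)]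
  rw [← withDensity_tsum fun n => (measurable_gammaPDF _ _).const_smul _]
  refine withDensity_congr_ae ?_
  filter_upwards [compl_mem_ae_iff.mpr (measure_singleton (0 : ℝ))] with x hx
  rw [tsum_apply (Pi.summable.mpr fun _ => ENNReal.summable)]
  simp only [Pi.smul_apply, smul_eq_mul]
  rcases lt_or_gt_of_ne (show x ≠ 0 from hx) with hx | hx
  · simp [gammaPDF_of_neg hx]
  · have hsum := hasSum_negBinomialWeight_mul_gammaPDFReal ha hr hc hx
    have hnn (n : ℕ) : 0 ≤ gammaPDFReal (a + n) (r / c) x :=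
      gammaPDFReal_nonneg (by positivity) (div_pos hr hc) x
    have hw := negBinomialWeight_nonneg ha hc hc1
    simp only [gammaPDF, ← ENNReal.ofReal_mul (hw _)]
    rw [← ENNReal.ofReal_tsum_of_nonneg (fun n => mul_nonneg (hw n) (hnn n)) hsum.summable,
      hsum.tsum_eq]

/-- The law of a sum of `n` independent exponential variables of rate `r`. -/
noncomputable def erlangMeasure (n : ℕ) (r : ℝ) : Measure ℝ :=
  if n = 0 then Measure.dirac 0 else gammaMeasure n r

theorem isProbabilityMeasure_erlangMeasure (n : ℕ) {r : ℝ} (hr : 0 < r) :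
    IsProbabilityMeasure (erlangMeasure n r) := by
  unfold erlangMeasure
  split_ifs with hn
  · infer_instance
  · exact isProbabilityMeasure_gammaMeasure (by positivity) hr

theorem gammaMeasure_conv_erlangMeasure {a r : ℝ} (ha : 0 < a) (hr : 0 < r) (n : ℕ) :
    (gammaMeasure a r).conv (erlangMeasure n r) = gammaMeasure (a + n) r := by
  have := isProbabilityMeasure_gammaMeasure ha hr
  unfold erlangMeasure
  split_ifs with hn
  · simp [hn, Measure.conv_dirac_zero]
  · exact gammaMeasure_conv_gammaMeasure ha (by positivity) hr

theorem conv_sum {μ : Measure ℝ} [SFinite μ] (ν : ℕ → Measure ℝ) [∀ n, SFinite (ν n)] :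
    μ.conv (Measure.sum ν) = Measure.sum fun n => μ.conv (ν n) := by
  unfold Measure.conv
  rw [Measure.prod_sum_right, Measure.map_sum (by fun_prop)]

/-- Example 3(a): every Gamma distribution is selfdecomposable. -/
theorem stmt_13 (α lam : ℝ) (hα : 0 < α) (hlam : 0 < lam) :
    SelfDecomposable (gammaMeasure α lam) := by
  rintro c ⟨hc, hc1⟩
  have hr : 0 < lam / c := div_pos hlam hc
  have := isProbabilityMeasure_gammaMeasure hα hr
  have hgamma := isProbabilityMeasure_gammaMeasure hα hlam
  have (n : ℕ) := isProbabilityMeasure_erlangMeasure n hr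
  let ν : Measure ℝ := Measure.sum fun n : ℕ =>
    ENNReal.ofReal (negBinomialWeight α c n) • erlangMeasure n (lam / c)
  have hν : gammaMeasure α lam = ((gammaMeasure α lam).map (fun x => c * x)).conv ν := by
    rw [map_const_mul_gammaMeasure α hlam hc, conv_sum, gammaMeasure_eq_sum hα hlam hc hc1]
    congr 1
    ext1 n
    rw [Measure.conv_comm, Measure.conv_smul_left, Measure.conv_comm,
      gammaMeasure_conv_erlangMeasure hα hr]
  refine ⟨ν, ⟨?_⟩, hν⟩
  have huniv := congrArg (fun μ => μ univ) hν
  rw [map_const_mul_gammaMeasure α hlam hc] at huniv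
  rw [Measure.conv, Measure.map_apply measurable_add MeasurableSet.univ, preimage_univ,
    ← univ_prod_univ, Measure.prod_prod, measure_univ, measure_univ, one_mul] at huniv
  exact huniv.symm
end

section
/- For every u > 0 there exists a selfdecomposable Borel probability measure μ on ℝ whose characteristic function is χ(t) = (tu/ sinh(tu)) · exp(−(tu·coth(tu) − 1)) for t ≠ 0 and χ(0) = 1. (Here χ is the conditional characteristic function of Lévy's stochastic area integral A_u given B_u = (√u, √u).) -/
open MeasureTheory Set

open Filter Topology

/-- `φ` is the characteristic function of a probability measure on `ℝ`. -/
def IsCharFun (φ : ℝ → ℂ) : Prop :=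
  ∃ μ : Measure ℝ, IsProbabilityMeasure μ ∧ ∀ t, charFun μ t = φ t

namespace IsCharFun

variable {φ ψ : ℝ → ℂ}

theorem one : IsCharFun fun _ => 1 :=
  ⟨Measure.dirac 0, inferInstance, fun t => by simp [charFun_dirac]⟩

theorem continuous (h : IsCharFun φ) : Continuous φ := by
  obtain ⟨μ, hμ, h⟩ := h
  rw [← funext h]
  fun_prop

theorem mul (hφ : IsCharFun φ) (hψ : IsCharFun ψ) : IsCharFun fun t => φ t * ψ t := by
  obtain ⟨μ, hμ, hφ⟩ := hφ
  obtain ⟨ν, hν, hψ⟩ := hψ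
  exact ⟨μ.conv ν, inferInstance, fun t => by rw [charFun_conv, hφ, hψ]⟩

theorem prod {ι : Type*} {f : ι → ℝ → ℂ} (s : Finset ι) (h : ∀ i ∈ s, IsCharFun (f i)) :
    IsCharFun fun t => ∏ i ∈ s, f i t := by
  classical
  induction s using Finset.induction_on with
  | empty => simpa using one
  | insert a s ha ih =>
    simp only [Finset.prod_insert ha]
    exact (h a (by simp)).mul (ih fun i hi => h i (by simp [hi]))

theorem pow (h : IsCharFun φ) (n : ℕ) : IsCharFun fun t => φ t ^ n := by
  simpa using prod (Finset.range n) (fun _ _ => h)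

theorem comp_mul (h : IsCharFun φ) (r : ℝ) : IsCharFun fun t => φ (r * t) := by
  obtain ⟨μ, hμ, h⟩ := h
  exact ⟨μ.map (r * ·), Measure.isProbabilityMeasure_map (by fun_prop),
    fun t => by rw [charFun_map_mul, h]⟩

theorem convex_comb (hφ : IsCharFun φ) (hψ : IsCharFun ψ) {a : ℝ} (ha : a ∈ Icc (0 : ℝ) 1) :
    IsCharFun fun t => a * φ t + (1 - a) * ψ t := by
  obtain ⟨μ, hμ, hφ⟩ := hφ
  obtain ⟨ν, hν, hψ⟩ := hψ
  have h1 : 0 ≤ 1 - a := by linarith [ha.2]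
  refine ⟨ENNReal.ofReal a • μ + ENNReal.ofReal (1 - a) • ν, ⟨?_⟩, fun t => ?_⟩
  · simp [← ENNReal.ofReal_add ha.1 h1]
  · have key (ρ : Measure ℝ) [IsProbabilityMeasure ρ] :
        Integrable (fun x : ℝ => Complex.exp (t * x * Complex.I)) ρ := by
      refine Integrable.of_bound (by fun_prop) 1 (ae_of_all _ fun x => ?_)
      rw [← Complex.ofReal_mul, Complex.norm_exp_ofReal_mul_I]
    rw [charFun_apply_real, integral_add_measure ((key μ).smul_measure (by simp))
      ((key ν).smul_measure (by simp)), integral_smul_measure, integral_smul_measure,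
      ← charFun_apply_real, ← charFun_apply_real, hφ, hψ, ENNReal.toReal_ofReal ha.1,
      ENNReal.toReal_ofReal h1]
    simp

theorem of_tendsto {f : ℕ → ℝ → ℂ} (hf : ∀ n, IsCharFun (f n)) (hφ : ContinuousAt φ 0)
    (h : ∀ t, Tendsto (fun n => f n t) atTop (𝓝 (φ t))) : IsCharFun φ := by
  choose μ hμ hfμ using hf
  simp only [← hfμ] at h
  let P : ℕ → ProbabilityMeasure ℝ := fun n => ⟨μ n, hμ n⟩
  have htight : IsTightMeasureSet {((ν : ProbabilityMeasure ℝ) : Measure ℝ) | ν ∈ range P} := by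
    have h_image : {((ν : ProbabilityMeasure ℝ) : Measure ℝ) | ν ∈ range P} = range μ := by
      rw [← image, ← range_comp]
      rfl
    exact h_image ▸ isTightMeasureSet_of_tendsto_charFun hφ h
  obtain ⟨ν, -, g, hg, hlim⟩ := (isCompact_closure_of_isTightMeasureSet htight).tendsto_subseq
    fun n => subset_closure (mem_range_self n)
  exact ⟨ν, inferInstance, fun t => tendsto_nhds_unique
    (ProbabilityMeasure.tendsto_iff_tendsto_charFun.1 hlim t) ((h t).comp hg.tendsto_atTop)⟩

/-- Compound Poisson laws. -/
theorem exp_mul_sub_one (h : IsCharFun φ) {a : ℝ} (ha : 0 ≤ a) :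
    IsCharFun fun t => Complex.exp (a * (φ t - 1)) := by
  obtain ⟨N, hN⟩ := exists_nat_gt a
  refine of_tendsto (f := fun n t => (((a / (n + N : ℕ) : ℝ) : ℂ) * φ t +
    (1 - ((a / (n + N : ℕ) : ℝ) : ℂ)) * 1) ^ (n + N)) (fun n => ?_) ?_ fun t => ?_
  · have hpos : (0 : ℝ) < (n + N : ℕ) := by push_cast; linarith [n.cast_nonneg (α := ℝ)]
    refine (h.convex_comb one ⟨by positivity, ?_⟩).pow _
    rw [div_le_one hpos]
    push_cast
    linarith [n.cast_nonneg (α := ℝ)]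
  · have := h.continuous
    fun_prop
  · refine ((tendsto_add_atTop_iff_nat N).2
      (Complex.tendsto_one_add_div_pow_exp (a * (φ t - 1)))).congr fun n => ?_
    congr 1
    push_cast
    ring

/-- Mixtures of the dilations by `c ^ s`, with `s` uniform on `[0, 1]`. -/
theorem intervalIntegral_comp_rpow (h : IsCharFun φ) (c : ℝ) :
    IsCharFun fun t => ∫ s in (0 : ℝ)..1, φ (c ^ s * t) := by
  obtain ⟨μ, hμ, h⟩ := h
  have : IsProbabilityMeasure (volume.restrict (Ioc (0 : ℝ) 1)) := ⟨by simp⟩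
  have hmeas : Measurable fun p : ℝ × ℝ => c ^ p.1 * p.2 := by fun_prop
  refine ⟨((volume.restrict (Ioc (0 : ℝ) 1)).prod μ).map fun p => c ^ p.1 * p.2,
    Measure.isProbabilityMeasure_map hmeas.aemeasurable, fun t => ?_⟩
  rw [charFun_apply_real, integral_map hmeas.aemeasurable (by fun_prop), integral_prod]
  · beta_reduce
    rw [intervalIntegral.integral_of_le zero_le_one]
    refine integral_congr_ae (ae_of_all _ fun s => ?_)
    simp only [← h, charFun_apply_real]
    congr with x
    push_cast
    ring_nf
  · refine Integrable.of_bound (by fun_prop) 1 (ae_of_all _ fun x => ?_)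
    rw [← Complex.ofReal_mul, Complex.norm_exp_ofReal_mul_I]

theorem exponential : IsCharFun fun t => (1 - t * Complex.I)⁻¹ := by
  have hint : IntegrableOn (fun x : ℝ => Real.exp (-x)) (Ioi 0) := integrableOn_exp_neg_Ioi 0
  refine ⟨(volume.restrict (Ioi 0)).withDensity fun x => ENNReal.ofReal (Real.exp (-x)),
    ⟨?_⟩, fun t => ?_⟩
  · rw [withDensity_apply _ MeasurableSet.univ, Measure.restrict_univ,
      ← ofReal_integral_eq_lintegral_ofReal hint (ae_of_all _ fun x => (Real.exp_pos _).le),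
      integral_exp_neg_Ioi_zero, ENNReal.ofReal_one]
  · have h0 : (t * Complex.I - 1 : ℂ).re < 0 := by simp
    have h1 := integral_exp_mul_complex_Ioi h0 0
    rw [charFun_apply_real, integral_withDensity_eq_integral_toReal_smul (by fun_prop)
      (ae_of_all _ fun x => ENNReal.ofReal_lt_top)]
    calc _ = ∫ x : ℝ in Ioi 0, Complex.exp ((t * Complex.I - 1) * x) := by
            congr with x
            rw [ENNReal.toReal_ofReal (Real.exp_pos _).le, Complex.real_smul,
              Complex.ofReal_exp, ← Complex.exp_add]
            push_cast
            ring_nf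
      _ = _ := by
            rw [h1, Complex.ofReal_zero, mul_zero, Complex.exp_zero, neg_div, ← div_neg, neg_sub,
              one_div]

/-- The symmetrized `Gamma(2, 1)` law. -/
theorem symm_gamma_two : IsCharFun fun t => (((1 - t ^ 2) / (1 + t ^ 2) ^ 2 : ℝ) : ℂ) := by
  have h := exponential.pow 2
  convert h.convex_comb (h.comp_mul (-1)) (a := 1 / 2) ⟨by norm_num, by norm_num⟩ using 2 with t
  have h1 : (1 - t * Complex.I : ℂ) ≠ 0 := fun h => by simpa using congrArg Complex.re h
  have h2 : (1 + t * Complex.I : ℂ) ≠ 0 := fun h => by simpa using congrArg Complex.re h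
  have h3 : (1 + t ^ 2 : ℂ) = (1 - t * Complex.I) * (1 + t * Complex.I) := by
    ring_nf
    simp
  push_cast
  rw [h3, neg_one_mul, neg_mul, sub_neg_eq_add]
  field_simp
  ring_nf
  simp
  ring

end IsCharFun

theorem exists_selfDecomposable_of_div {φ : ℝ → ℂ} (hcont : ContinuousAt φ 0) (h0 : φ 0 = 1)
    (hne : ∀ t, φ t ≠ 0) (h : ∀ c ∈ Ioo (0 : ℝ) 1, IsCharFun fun t => φ t / φ (c * t)) :
    ∃ μ : Measure ℝ, IsProbabilityMeasure μ ∧ SelfDecomposable μ ∧ ∀ t, charFun μ t = φ t := by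
  have hφ : IsCharFun φ := by
    have hc : Tendsto (fun n : ℕ => 1 / ((n + 1 : ℕ) + 1 : ℝ)) atTop (𝓝 0) :=
      (tendsto_add_atTop_iff_nat 1).2 tendsto_one_div_add_atTop_nhds_zero_nat
    refine IsCharFun.of_tendsto (fun n : ℕ => h (1 / ((n + 1 : ℕ) + 1)) ⟨by positivity, ?_⟩)
      hcont fun t => ?_
    · rw [div_lt_one (by positivity)]
      push_cast
      linarith [n.cast_nonneg (α := ℝ)]
    · have h1 := hcont.tendsto.comp (by simpa using hc.mul_const t)
      simpa [h0, Function.comp_def, Pi.div_def] using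
        tendsto_const_nhds (x := φ t) |>.div h1 (by simp [h0])
  obtain ⟨μ, hμ, hμφ⟩ := hφ
  refine ⟨μ, hμ, fun c hc => ?_, hμφ⟩
  obtain ⟨ν, hν, hνφ⟩ := h c hc
  refine ⟨ν, hν, Measure.ext_of_charFun (funext fun t => ?_)⟩
  rw [charFun_conv, charFun_map_mul, hμφ, hμφ, hνφ, mul_div_cancel₀ _ (hne _)]

/-- The characteristic function of the convolution of a Laplace law and the compound Poisson law
of rate `2` with Laplace jumps. -/
noncomputable def laplaceFactor (t : ℝ) : ℝ :=
  (1 + t ^ 2)⁻¹ * Real.exp (-(2 * t ^ 2 / (1 + t ^ 2)))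

theorem laplaceFactor_eq_exp (t : ℝ) :
    laplaceFactor t = Real.exp (-(Real.log (1 + t ^ 2) + 2 * t ^ 2 / (1 + t ^ 2))) := by
  rw [laplaceFactor, neg_add, Real.exp_add, Real.exp_neg (Real.log _),
    Real.exp_log (by positivity)]

theorem integral_comp_rpow_eq_sub {c : ℝ} (hc : 0 < c) (t : ℝ) :
    ∫ s in (0 : ℝ)..1,
      2 * Real.log c * (1 - (1 - (c ^ s * t) ^ 2) / (1 + (c ^ s * t) ^ 2) ^ 2) =
    (Real.log (1 + (c * t) ^ 2) + 2 * (c * t) ^ 2 / (1 + (c * t) ^ 2)) -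
      (Real.log (1 + t ^ 2) + 2 * t ^ 2 / (1 + t ^ 2)) := by
  have hpos (y : ℝ) : 1 + y ^ 2 ≠ 0 := by positivity
  have hrpow : Continuous fun s : ℝ => c ^ s := Real.continuous_const_rpow hc.ne'
  have hd (s : ℝ) (_ : s ∈ uIcc (0 : ℝ) 1) : HasDerivAt
      (fun s : ℝ => Real.log (1 + (c ^ s * t) ^ 2) + 2 * (c ^ s * t) ^ 2 / (1 + (c ^ s * t) ^ 2))
      (2 * Real.log c * (1 - (1 - (c ^ s * t) ^ 2) / (1 + (c ^ s * t) ^ 2) ^ 2)) s := by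
    have h1 : HasDerivAt (fun s : ℝ => (c ^ s * t) ^ 2) (2 * Real.log c * (c ^ s * t) ^ 2) s := by
      refine (((Real.hasStrictDerivAt_const_rpow hc s).hasDerivAt.mul_const t).pow 2).congr_deriv ?_
      push_cast
      ring
    have h2 := h1.const_add 1
    refine ((h2.log (hpos _)).add ((h1.const_mul 2).div h2 (hpos _))).congr_deriv ?_
    have := hpos (c ^ s * t)
    field_simp
    ring
  rw [intervalIntegral.integral_eq_sub_of_hasDerivAt hd]
  · simp
  · refine Continuous.intervalIntegrable ?_ _ _
    fun_prop (disch := intro; positivity)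

theorem isCharFun_laplaceFactor_div {c : ℝ} (hc : c ∈ Ioo (0 : ℝ) 1) :
    IsCharFun fun t => ((laplaceFactor t / laplaceFactor (c * t) : ℝ) : ℂ) := by
  have hlog : 0 ≤ -(2 * Real.log c) := by linarith [Real.log_neg hc.1 hc.2]
  convert (IsCharFun.symm_gamma_two.intervalIntegral_comp_rpow c).exp_mul_sub_one hlog
    using 2 with t
  have hrpow : Continuous fun s : ℝ => c ^ s := Real.continuous_const_rpow hc.1.ne'
  have h := integral_comp_rpow_eq_sub hc.1 t
  rw [intervalIntegral.integral_const_mul, intervalIntegral.integral_sub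
    intervalIntegrable_const] at h
  · rw [intervalIntegral.integral_ofReal, laplaceFactor_eq_exp, laplaceFactor_eq_exp,
      ← Real.exp_sub, ← Complex.ofReal_one, ← Complex.ofReal_sub, ← Complex.ofReal_mul,
      ← Complex.ofReal_exp]
    congr 2
    rw [neg_sub_neg, ← h]
    simp
    ring
  · refine Continuous.intervalIntegrable ?_ _ _
    fun_prop (disch := intro; positivity)

/-- `χ` for `u = 1`. -/
noncomputable def levyArea (x : ℝ) : ℝ :=
  if x = 0 then 1 else x / Real.sinh x * Real.exp (-(x * (Real.cosh x / Real.sinh x) - 1))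

theorem levyArea_pos (x : ℝ) : 0 < levyArea x := by
  rw [levyArea]
  split_ifs with hx
  · exact one_pos
  · refine mul_pos ?_ (Real.exp_pos _)
    rcases lt_or_gt_of_ne hx with h | h
    · exact div_pos_of_neg_of_neg h (Real.sinh_neg_iff.2 h)
    · exact div_pos h (Real.sinh_pos_iff.2 h)

theorem continuousAt_levyArea_zero : ContinuousAt levyArea 0 := by
  have hS : ContinuousAt (dslope Real.sinh 0) 0 :=
    continuousAt_dslope_same.2 Real.differentiable_sinh.differentiableAt
  have h0 : dslope Real.sinh 0 0 = 1 := by simp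
  have h : levyArea = fun x => (dslope Real.sinh 0 x)⁻¹ *
      Real.exp (-(Real.cosh x * (dslope Real.sinh 0 x)⁻¹ - 1)) := by
    funext x
    rw [levyArea]
    split_ifs with hx
    · simp [hx]
    · rw [dslope_of_ne _ hx, slope_def_field]
      simp only [Real.sinh_zero, sub_zero, inv_div]
      ring_nf
  rw [h]
  have hinv := hS.inv₀ (by simp)
  have hcosh := Real.continuous_cosh.continuousAt (x := (0 : ℝ))
  exact hinv.mul (((hcosh.mul hinv).sub continuousAt_const).neg.rexp)

theorem mul_I_div_pi_mem_integerComplement {x : ℝ} (hx : x ≠ 0) :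
    (x / Real.pi * Complex.I : ℂ) ∈ Complex.integerComplement := by
  rintro ⟨n, hn⟩
  have := congrArg Complex.im hn
  rw [← Complex.ofReal_div] at this
  simp [Real.pi_ne_zero, hx, eq_comm] at this

theorem tendsto_prod_sinh_div {x : ℝ} (hx : x ≠ 0) :
    Tendsto (fun n => ∏ i ∈ Finset.range n, (1 + (x / (Real.pi * (i + 1))) ^ 2)) atTop
      (𝓝 (Real.sinh x / x)) := by
  have hpi : (Real.pi : ℂ) ≠ 0 := by simp [Real.pi_ne_zero]
  have h := tendsto_euler_sin_prod'
    (Complex.integerComplement.ne_zero (mul_I_div_pi_mem_integerComplement hx))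
  rw [← mul_assoc, mul_div_cancel₀ _ hpi, Complex.sin_mul_I,
    mul_div_mul_right _ _ Complex.I_ne_zero] at h
  rw [← Filter.tendsto_ofReal_iff]
  push_cast
  refine h.congr fun n => Finset.prod_congr rfl fun i _ => ?_
  rw [sineTerm, mul_pow, Complex.I_sq]
  field_simp

theorem tendsto_sum_coth {x : ℝ} (hx : x ≠ 0) :
    Tendsto (fun n => ∑ i ∈ Finset.range n,
        2 * (x / (Real.pi * (i + 1))) ^ 2 / (1 + (x / (Real.pi * (i + 1))) ^ 2)) atTop
      (𝓝 (x * (Real.cosh x / Real.sinh x) - 1)) := by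
  have hz := mul_I_div_pi_mem_integerComplement hx
  have hpi : (Real.pi : ℂ) ≠ 0 := by simp [Real.pi_ne_zero]
  have hx' : (x : ℂ) ≠ 0 := by exact_mod_cast hx
  have h := (tendsto_logDeriv_euler_cot_sub hz).const_mul (x / Real.pi * Complex.I : ℂ)
  rw [← Filter.tendsto_ofReal_iff]
  convert h using 1
  · funext n
    push_cast
    rw [Finset.mul_sum]
    refine Finset.sum_congr rfl fun i _ => ?_
    have hd : (1 + (x / (Real.pi * (i + 1))) ^ 2 : ℂ) ≠ 0 := by
      norm_cast
      positivity
    have hi : (i + 1 : ℂ) ≠ 0 := by exact_mod_cast i.succ_ne_zero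
    rw [cotTerm_identity hz, ← sq_sub_sq, mul_pow, Complex.I_sq]
    have hd' : (x / Real.pi : ℂ) ^ 2 * -1 - (i + 1) ^ 2 ≠ 0 := by
      convert mul_ne_zero (mul_ne_zero hi hi) (neg_ne_zero.2 hd) using 1
      field_simp
      ring
    rw [mul_one_div, mul_div_assoc', div_eq_div_iff hd hd']
    field_simp
    ring_nf
    simp [Complex.I_sq]
    ring
  · rw [← mul_assoc (Real.pi : ℂ), mul_div_cancel₀ _ hpi, Complex.cot_eq_cos_div_sin,
      Complex.sin_mul_I, Complex.cos_mul_I]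
    push_cast
    field_simp

theorem tendsto_prod_laplaceFactor (x : ℝ) :
    Tendsto (fun n => ∏ i ∈ Finset.range n, laplaceFactor (x / (Real.pi * (i + 1)))) atTop
      (𝓝 (levyArea x)) := by
  rcases eq_or_ne x 0 with rfl | hx
  · simp [laplaceFactor, levyArea]
  · rw [levyArea, if_neg hx, ← inv_div]
    have hne : Real.sinh x / x ≠ 0 := div_ne_zero (by simpa using hx) hx
    refine (((tendsto_prod_sinh_div hx).inv₀ hne).mul (tendsto_sum_coth hx).neg.rexp).congr
      fun n => ?_
    simp only [laplaceFactor]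
    rw [Finset.prod_mul_distrib, ← Real.exp_sum, Finset.prod_inv_distrib, Finset.sum_neg_distrib]

theorem isCharFun_levyArea_div {c : ℝ} (hc : c ∈ Ioo (0 : ℝ) 1) :
    IsCharFun fun t => ((levyArea t / levyArea (c * t) : ℝ) : ℂ) := by
  have hcont : ContinuousAt (fun t => levyArea t / levyArea (c * t)) 0 := by
    refine continuousAt_levyArea_zero.div ?_ (levyArea_pos _).ne'
    exact ContinuousAt.comp' (by simpa using continuousAt_levyArea_zero) (by fun_prop)
  refine IsCharFun.of_tendsto (f := fun n t => ∏ i ∈ Finset.range n, ((laplaceFactor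
      ((Real.pi * (i + 1))⁻¹ * t) / laplaceFactor (c * ((Real.pi * (i + 1))⁻¹ * t)) : ℝ) : ℂ))
    (fun n => IsCharFun.prod _ fun i _ => (isCharFun_laplaceFactor_div hc).comp_mul _)
    (Complex.continuous_ofReal.continuousAt.comp hcont) fun t => ?_
  refine ((Complex.continuous_ofReal.tendsto _).comp ((tendsto_prod_laplaceFactor t).div
    (tendsto_prod_laplaceFactor (c * t)) (levyArea_pos _).ne')).congr fun n => ?_
  simp only [Function.comp_apply, Pi.div_apply, ← Finset.prod_div_distrib]
  rw [Complex.ofReal_prod]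
  refine Finset.prod_congr rfl fun i _ => ?_
  congr 3 <;> ring

/-- Example B.1 (Lévy's stochastic area integral): for every `u > 0` there is a
selfdecomposable probability measure on `ℝ` with characteristic function
`χ(t) = (tu/sinh(tu)) exp(-(tu·coth(tu) - 1))` for `t ≠ 0`, `χ(0) = 1`. -/
theorem stmt_17 (u : ℝ) (hu : 0 < u) :
    ∃ μ : Measure ℝ, IsProbabilityMeasure μ ∧ SelfDecomposable μ ∧
      ∀ t : ℝ,
        (∫ x, Complex.exp (t * x * Complex.I) ∂μ)
          = if t = 0 then 1 else
              ((t * u / Real.sinh (t * u) : ℝ) : ℂ) *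
                Complex.exp
                  (-((t * u * (Real.cosh (t * u) / Real.sinh (t * u)) - 1 : ℝ) : ℂ)) := by
  have hcont : ContinuousAt (fun t => (levyArea (t * u) : ℂ)) 0 :=
    Complex.continuous_ofReal.continuousAt.comp
      (ContinuousAt.comp' (by simpa using continuousAt_levyArea_zero) (by fun_prop))
  obtain ⟨μ, hμ, hsd, hμu⟩ := exists_selfDecomposable_of_div hcont (by simp [levyArea])
    (fun t => by exact_mod_cast (levyArea_pos _).ne') fun c hc => by
      simpa [mul_comm, mul_left_comm] using (isCharFun_levyArea_div hc).comp_mul u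
  refine ⟨μ, hμ, hsd, fun t => ?_⟩
  rw [← charFun_apply_real, hμu, levyArea]
  simp only [mul_eq_zero, hu.ne', or_false]
  split_ifs <;> simp
end
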